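/- arXiv:1504.06671 — 3 statements merged into one kernel-verified Lean document; each statement's English description precedes it below -/
import Mathlib

section
/- Let K be a finite extension of ℚ_p, n a positive integer, and J_0 ∈ ℤ; write J_0 = a_0·n + b_0 with a_0, b_0 ∈ ℤ and 0 ≤ b_0 < n. Then there exists a totally ramified extension L/K of degree n with discriminant (π)^{n+J_0−1} if and only if min{v_π(b_0)·n, v_π(n)·n} ≤ J_0 ≤ v_π(n)·n (with the convention v_π(0) = ∞). -/
open Polynomial IntermediateField

namespace RamificationStmt0

/-- `φ` is an Eisenstein polynomial with respect to the additive valuation `v`. -/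
def IsEisenstein {K : Type*} [Field K] (v : AddValuation K (WithTop ℤ)) (φ : Polynomial K) : Prop :=
  φ.Monic ∧ (∀ i < φ.natDegree, ((1 : ℤ) : WithTop ℤ) ≤ v (φ.coeff i)) ∧
    v (φ.coeff 0) = ((1 : ℤ) : WithTop ℤ)

lemma exists_valuation {K E : Type*} [Field K] [Field E] [Algebra K E]
    (v : AddValuation K (WithTop ℤ)) :
    ∃ B : ValuationSubring E, (∀ x : K, 0 ≤ v x → B.valuation (algebraMap K E x) ≤ 1) ∧
      (∀ x : K, 0 < v x → B.valuation (algebraMap K E x) < 1) := by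
  let A : Subring E :=
    { carrier := {y | ∃ x : K, 0 ≤ v x ∧ algebraMap K E x = y}
      mul_mem' := by
        rintro _ _ ⟨x, hx, rfl⟩ ⟨y, hy, rfl⟩
        exact ⟨x * y, by rw [v.map_mul]; exact add_nonneg hx hy, map_mul _ _ _⟩
      one_mem' := ⟨1, by simp, map_one _⟩
      add_mem' := by
        rintro _ _ ⟨x, hx, rfl⟩ ⟨y, hy, rfl⟩
        exact ⟨x + y, v.map_le_add hx hy, map_add _ _ _⟩
      zero_mem' := ⟨0, by simp, map_zero _⟩
      neg_mem' := by
        rintro _ ⟨x, hx, rfl⟩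
        exact ⟨-x, by rwa [v.map_neg], map_neg _ _⟩ }
  let I : Ideal A :=
    { carrier := {y | ∃ x : K, 0 < v x ∧ algebraMap K E x = y}
      add_mem' := by
        rintro _ _ ⟨x, hx, hx'⟩ ⟨y, hy, hy'⟩
        exact ⟨x + y, v.map_lt_add hx hy, by rw [map_add, hx', hy']; rfl⟩
      zero_mem' := ⟨0, by simp, map_zero _⟩
      smul_mem' := by
        rintro ⟨_, x, hx, rfl⟩ a ⟨y, hy, hy'⟩
        exact ⟨x * y, by rw [v.map_mul]; exact lt_of_lt_of_le hy (le_add_of_nonneg_left hx), by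
          rw [map_mul, hy']; rfl⟩ }
  have hI : I ≠ ⊤ := by
    rw [Ideal.ne_top_iff_one]
    rintro ⟨x, hx, hx'⟩
    have : x = 1 := (algebraMap K E).injective (by rw [hx', map_one]; rfl)
    subst this
    simp at hx
  obtain ⟨B, hAB, hIB⟩ := Ideal.image_subset_nonunits_valuationSubring I hI
  refine ⟨B, fun x hx => ?_, fun x hx => ?_⟩
  · rw [ValuationSubring.valuation_le_one_iff]
    exact hAB ⟨x, hx, rfl⟩
  · rw [← ValuationSubring.mem_nonunits_iff]
    exact hIB ⟨⟨_, x, hx.le, rfl⟩, ⟨x, hx, rfl⟩, rfl⟩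

lemma v_inv {K : Type*} [Field K] (v : AddValuation K (WithTop ℤ)) (x : K) (m : ℤ)
    (hx : v x = (m : WithTop ℤ)) : v x⁻¹ = ((-m : ℤ) : WithTop ℤ) := by
  have h0 : x ≠ 0 := by rintro rfl; simp at hx
  have h : v (x * x⁻¹) = 0 := by rw [mul_inv_cancel₀ h0]; simp
  rw [v.map_mul, hx] at h
  cases h2 : v x⁻¹ with
  | top => rw [h2] at h; simp at h
  | coe a =>
    rw [h2] at h
    norm_cast at h ⊢
    omega

lemma v_zpow {K : Type*} [Field K] (v : AddValuation K (WithTop ℤ)) (x : K)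
    (hx : v x = ((1 : ℤ) : WithTop ℤ)) (m : ℤ) : v (x ^ m) = (m : WithTop ℤ) := by
  have hnat : ∀ k : ℕ, v (x ^ k) = ((k : ℤ) : WithTop ℤ) := by
    intro k
    rw [v.map_pow, hx]
    norm_cast
    simp
  obtain ⟨k, rfl | rfl⟩ := m.eq_nat_or_neg
  · rw [zpow_natCast, hnat]
  · rw [zpow_neg, zpow_natCast, v_inv v _ _ (hnat k)]

lemma w_eq {K E : Type*} [Field K] [Field E] [Algebra K E]
    (v : AddValuation K (WithTop ℤ)) (π : K) (hπ : v π = ((1 : ℤ) : WithTop ℤ))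
    (B : ValuationSubring E) (hB : ∀ x : K, 0 ≤ v x → B.valuation (algebraMap K E x) ≤ 1)
    (x : K) (m : ℤ) (hx : v x = (m : WithTop ℤ)) :
    B.valuation (algebraMap K E x) = B.valuation (algebraMap K E π) ^ m := by
  have hx0 : x ≠ 0 := by rintro rfl; simp at hx
  have hπ0 : π ≠ 0 := by rintro rfl; simp at hπ
  have hπm := zpow_ne_zero m hπ0
  have h1 : v (x * (π ^ m)⁻¹) = 0 := by
    rw [v.map_mul, hx, v_inv v _ _ (v_zpow v π hπ m)]
    norm_cast; omega
  have h2 : v (x⁻¹ * (π ^ m)) = 0 := by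
    rw [v.map_mul, v_inv v _ _ hx, v_zpow v π hπ m]
    norm_cast; omega
  have h1' := hB _ h1.ge
  have h2' := hB _ h2.ge
  have hw : B.valuation (algebraMap K E (π ^ m)) = B.valuation (algebraMap K E π) ^ m := by
    rw [map_zpow₀, map_zpow₀]
  rw [← hw]
  have p1 : 0 < B.valuation (algebraMap K E (π ^ m)) := by
    rw [zero_lt_iff, hw]; exact zpow_ne_zero _ (by simp [hπ0])
  have p2 : 0 < B.valuation (algebraMap K E x) := by
    rw [zero_lt_iff]; simp [hx0]
  rw [map_mul, map_mul, map_inv₀, map_inv₀] at h1' h2'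
  apply le_antisymm
  · rwa [← div_eq_mul_inv, div_le_one₀ p1] at h1'
  · rwa [mul_comm, ← div_eq_mul_inv, div_le_one₀ p2] at h2'

/-- bundled data about the extended valuation -/
lemma exists_w {K E : Type*} [Field K] [Field E] [Algebra K E]
    (v : AddValuation K (WithTop ℤ)) (π : K) (hπ : v π = ((1 : ℤ) : WithTop ℤ)) :
    ∃ B : ValuationSubring E, 0 < B.valuation (algebraMap K E π) ∧
      B.valuation (algebraMap K E π) < 1 ∧
      ∀ (x : K) (m : ℤ), v x = (m : WithTop ℤ) →
        B.valuation (algebraMap K E x) = B.valuation (algebraMap K E π) ^ m := by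
  obtain ⟨B, h1, h2⟩ := exists_valuation (E := E) v
  have hπ0 : π ≠ 0 := by rintro rfl; simp at hπ
  exact ⟨B, by rw [zero_lt_iff]; simp [hπ0], h2 π (by rw [hπ]; norm_cast), w_eq v π hπ B h1⟩

lemma v_cases {K : Type*} [Field K] (v : AddValuation K (WithTop ℤ)) (x : K) :
    x = 0 ∨ ∃ m : ℤ, v x = m := by
  cases h : v x with
  | top => exact Or.inl (by simpa using h)
  | coe a => exact Or.inr ⟨a, rfl⟩

/-- every root of an Eisenstein polynomial has valuation `1/n`. -/
lemma root_val {K E Γ : Type*} [Field K] [Field E] [Algebra K E]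
    [LinearOrderedCommGroupWithZero Γ] (w : Valuation E Γ)
    (v : AddValuation K (WithTop ℤ)) (g : Γ) (hg0 : 0 < g) (hg1 : g < 1)
    (hw : ∀ (x : K) (m : ℤ), v x = (m : WithTop ℤ) → w (algebraMap K E x) = g ^ m)
    (φ : K[X]) (hφ : IsEisenstein v φ) (hn : 0 < φ.natDegree) (β : E) (hβ : aeval β φ = 0) :
    w β ^ φ.natDegree = g ∧ 0 < w β ∧ w β < 1 := by
  obtain ⟨hm, hi, h0⟩ := hφ
  have hc : ∀ i < φ.natDegree, w (algebraMap K E (φ.coeff i)) ≤ g := by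
    intro i hin
    rcases v_cases v (φ.coeff i) with h | ⟨m, h⟩
    · rw [h]; simp
    · rw [hw _ _ h]
      have := hi i hin
      rw [h] at this
      norm_cast at this
      calc g ^ m ≤ g ^ (1 : ℤ) := (zpow_le_zpow_iff_right_of_lt_one₀ hg0 hg1).2 this
        _ = g := zpow_one g
  have hc0 : w (algebraMap K E (φ.coeff 0)) = g := by rw [hw _ _ h0, zpow_one]
  rw [aeval_eq_sum_range, Finset.sum_range_succ, coeff_natDegree, hm.leadingCoeff, one_smul,
    add_comm, add_eq_zero_iff_eq_neg] at hβ
  have hβw : w β ^ φ.natDegree = w (∑ i ∈ Finset.range φ.natDegree, φ.coeff i • β ^ i) := by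
    rw [← w.map_pow, hβ, w.map_neg]
  have hlt : w β < 1 := by
    by_contra hge
    rw [not_lt] at hge
    have : w (∑ i ∈ Finset.range φ.natDegree, φ.coeff i • β ^ i) < w β ^ φ.natDegree := by
      apply w.map_sum_lt
      · exact pow_ne_zero _ (lt_of_lt_of_le zero_lt_one hge).ne'
      · intro i hin
        rw [Finset.mem_range] at hin
        rw [Algebra.smul_def, w.map_mul, w.map_pow]
        calc w (algebraMap K E (φ.coeff i)) * w β ^ i ≤ g * w β ^ i := by
              gcongr; exact hc i hin
          _ < 1 * w β ^ i := by
              have : 0 < w β ^ i := pow_pos (lt_of_lt_of_le zero_lt_one hge) _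
              exact mul_lt_mul_of_pos_right hg1 this
          _ = w β ^ i := one_mul _
          _ ≤ w β ^ φ.natDegree := pow_le_pow_right₀ hge hin.le
    exact absurd hβw this.ne'
  have hsum : w (∑ i ∈ Finset.range φ.natDegree, φ.coeff i • β ^ i) = g := by
    rw [w.map_sum_eq_of_lt (j := 0) (by simpa using hn)]
    · simpa [Algebra.smul_def] using hc0
    · intro i hin
      simp only [Finset.mem_sdiff, Finset.mem_range, Finset.mem_singleton] at hin
      simp only [Algebra.smul_def, w.map_mul, w.map_pow, pow_zero, mul_one]
      rw [hc0]
      calc w (algebraMap K E (φ.coeff i)) * w β ^ i ≤ g * w β ^ i := by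
              gcongr; exact hc i hin.1
        _ < g * 1 := mul_lt_mul_of_pos_left (pow_lt_one₀ zero_le hlt hin.2) hg0
        _ = g := mul_one g
  have heq := hβw.trans hsum
  refine ⟨heq, ?_, hlt⟩
  rw [zero_lt_iff]
  intro h
  rw [h, zero_pow hn.ne'] at heq
  exact hg0.ne heq

/-- valuation of `φ'(β)`. -/
lemma deriv_val {K E Γ : Type*} [Field K] [Field E] [Algebra K E]
    [LinearOrderedCommGroupWithZero Γ] (w : Valuation E Γ)
    (v : AddValuation K (WithTop ℤ)) (g : Γ)
    (hw : ∀ (x : K) (m : ℤ), v x = (m : WithTop ℤ) → w (algebraMap K E x) = g ^ m)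
    (φ : K[X]) (β : E) (n : ℕ) (hφn : φ.natDegree = n)
    (h1 : w β ^ n = g) (h2 : 0 < w β) (h3 : w β < 1) (k : ℕ) (hk1 : 1 ≤ k) (hkn : k ≤ n)
    (m : ℤ) (hm : v ((k : K) * φ.coeff k) = (m : WithTop ℤ))
    (hmin : ∀ i, 1 ≤ i → i ≤ n → ∀ a : ℤ, v ((i : K) * φ.coeff i) = (a : WithTop ℤ) →
      n * m + k ≤ n * a + i) :
    w (aeval β φ.derivative) = w β ^ ((n : ℤ) * m + k - 1) := by
  have hterm : ∀ i, ∀ a : ℤ, v (((i + 1 : ℕ) : K) * φ.coeff (i + 1)) = (a : WithTop ℤ) →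
      w (φ.derivative.coeff i • β ^ i) = w β ^ ((n : ℤ) * a + i) := by
    intro i a ha
    rw [coeff_derivative, Algebra.smul_def, w.map_mul, w.map_pow, mul_comm (φ.coeff (i + 1))]
    push_cast at ha
    rw [hw _ _ ha, ← h1, zpow_add₀ h2.ne', zpow_mul]
    simp
  obtain ⟨k, rfl⟩ : ∃ k', k = k' + 1 := ⟨k - 1, by omega⟩
  have hdeg : φ.derivative.natDegree < n := by
    rw [← hφn]; exact natDegree_derivative_lt (by omega)
  rw [aeval_eq_sum_range' hdeg, w.map_sum_eq_of_lt (j := k) (by simpa using hkn)]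
  · rw [hterm k m hm]
    congr 1; push_cast; ring
  · intro i hi
    simp only [Finset.mem_sdiff, Finset.mem_range, Finset.mem_singleton] at hi
    rw [hterm k m hm]
    rcases v_cases v (((i + 1 : ℕ) : K) * φ.coeff (i + 1)) with h | ⟨a, h⟩
    · have : φ.derivative.coeff i = 0 := by
        rw [coeff_derivative, mul_comm]; exact_mod_cast h
      rw [this, zero_smul, w.map_zero]
      exact zpow_pos h2 _
    · rw [hterm i a h]
      apply (zpow_lt_zpow_iff_right_of_lt_one₀ h2 h3).2
      have hle := hmin (i + 1) (by omega) (by omega) a h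
      push_cast at hle
      refine lt_of_le_of_ne (by linarith) ?_
      intro heq
      apply hi.2
      have e1 : ((n : ℤ) * m + k) % n = k := by
        rw [Int.mul_add_emod_self_left]; apply Int.emod_eq_of_lt <;> omega
      have e2 : ((n : ℤ) * a + i) % n = i := by
        rw [Int.mul_add_emod_self_left]; apply Int.emod_eq_of_lt <;> omega
      rw [heq, e2] at e1
      exact_mod_cast e1

/-- Norm computation. -/
lemma norm_val {K : Type*} [Field K] [CharZero K] (v : AddValuation K (WithTop ℤ)) (π : K)
    (hπ : v π = ((1 : ℤ) : WithTop ℤ)) (B : ValuationSubring (AlgebraicClosure K))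
    (hg0 : 0 < B.valuation (algebraMap K (AlgebraicClosure K) π))
    (hg1 : B.valuation (algebraMap K (AlgebraicClosure K) π) < 1)
    (hw : ∀ (x : K) (m : ℤ), v x = (m : WithTop ℤ) →
        B.valuation (algebraMap K (AlgebraicClosure K) x) =
          B.valuation (algebraMap K (AlgebraicClosure K) π) ^ m)
    (α : AlgebraicClosure K) (f : K[X]) (n : ℕ) (hn : 0 < n) (M : ℤ)
    (h : ∀ β : AlgebraicClosure K, aeval β (minpoly K α) = 0 →
      B.valuation (aeval β f) ^ n = B.valuation (algebraMap K (AlgebraicClosure K) π) ^ M) :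
    ∃ a : ℤ, v (Algebra.norm K (aeval (AdjoinSimple.gen K α) f)) = (a : WithTop ℤ) ∧
      n * a = (minpoly K α).natDegree * M := by
  have hint : IsIntegral K α := Algebra.IsIntegral.isIntegral α
  have : FiniteDimensional K K⟮α⟯ := adjoin.finiteDimensional hint
  have hN := Algebra.norm_eq_prod_embeddings K (AlgebraicClosure K)
    (aeval (AdjoinSimple.gen K α) f)
  have hN2 : B.valuation (algebraMap K (AlgebraicClosure K)
      (Algebra.norm K (aeval (AdjoinSimple.gen K α) f))) ^ n =
      B.valuation (algebraMap K (AlgebraicClosure K) π) ^ ((minpoly K α).natDegree * M) := by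
    rw [hN, map_prod, ← Finset.prod_pow, Finset.prod_congr rfl (g := fun _ =>
      B.valuation (algebraMap K (AlgebraicClosure K) π) ^ M)]
    · rw [Finset.prod_const, Finset.card_univ, AlgHom.card, adjoin.finrank hint, mul_comm,
        zpow_mul, zpow_natCast]
    · intro σ _
      have := h (σ (AdjoinSimple.gen K α)) (by
        rw [aeval_algHom_apply, ← minpoly_gen K α, minpoly.aeval, map_zero])
      rw [aeval_algHom_apply] at this
      exact this
  rcases v_cases v (Algebra.norm K (aeval (AdjoinSimple.gen K α) f)) with h0 | ⟨a, ha⟩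
  · rw [h0, map_zero, map_zero, zero_pow hn.ne'] at hN2
    exact absurd hN2 (zpow_pos hg0 _).ne
  · refine ⟨a, ha, ?_⟩
    rw [hw _ _ ha, ← zpow_natCast, ← zpow_mul] at hN2
    rw [mul_comm]
    exact (zpow_right_strictAnti₀ hg0 hg1).injective hN2

lemma discr_val {K : Type*} [Field K] [CharZero K] (v : AddValuation K (WithTop ℤ)) (π : K)
    (hπ : v π = ((1 : ℤ) : WithTop ℤ)) (α : AlgebraicClosure K) (n : ℕ) (hn : 0 < n)
    (hdeg : (minpoly K α).natDegree = n) (hE : IsEisenstein v (minpoly K α))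
    (k : ℕ) (hk1 : 1 ≤ k) (hkn : k ≤ n)
    (m : ℤ) (hm : v ((k : K) * (minpoly K α).coeff k) = (m : WithTop ℤ))
    (hmin : ∀ i, 1 ≤ i → i ≤ n → ∀ a : ℤ, v ((i : K) * (minpoly K α).coeff i) = (a : WithTop ℤ) →
      n * m + k ≤ n * a + i) :
    v (Algebra.discr K
      (fun i : Fin n => (IntermediateField.AdjoinSimple.gen K α) ^ (i : ℕ))) =
        ((n * m + k - 1 : ℤ) : WithTop ℤ) := by
  obtain ⟨B, hg0, hg1, hw⟩ := exists_w (E := AlgebraicClosure K) v π hπ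
  obtain ⟨a, ha, haM⟩ := norm_val v π hπ B hg0 hg1 hw α (minpoly K α).derivative n hn
    (n * m + k - 1) (by
      intro β hβ
      obtain ⟨h1, h2, h3⟩ := root_val B.valuation v _ hg0 hg1 hw _ hE (by omega) β hβ
      rw [hdeg] at h1
      rw [deriv_val B.valuation v _ hw _ β n hdeg h1 h2 h3 k hk1 hkn m hm hmin, ← zpow_natCast,
        ← zpow_mul, mul_comm, zpow_mul, zpow_natCast, h1])
  rw [hdeg] at haM
  have haM : a = n * m + k - 1 := mul_left_cancel₀ (by exact_mod_cast hn.ne') haM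
  rw [← haM, ← ha]
  have hint : IsIntegral K α := Algebra.IsIntegral.isIntegral α
  have : FiniteDimensional K K⟮α⟯ := adjoin.finiteDimensional hint
  have hd := Algebra.discr_powerBasis_eq_norm K (adjoin.powerBasis hint)
  rw [adjoin.powerBasis_gen, minpoly_gen] at hd
  have hdim : (adjoin.powerBasis hint).dim = n := by rw [adjoin.powerBasis_dim, hdeg]
  have hre : Algebra.discr K (adjoin.powerBasis hint).basis = Algebra.discr K
      (fun i : Fin n => (IntermediateField.AdjoinSimple.gen K α) ^ (i : ℕ)) := by
    rw [PowerBasis.coe_basis, adjoin.powerBasis_gen]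
    subst hdim
    rfl
  rw [← hre, hd, v.map_mul, v.map_pow, v.map_neg, v.map_one, smul_zero, zero_add]

/-- Eisenstein polynomials are minimal polynomials of their roots. -/
lemma minpoly_eq {K : Type*} [Field K] [CharZero K] (v : AddValuation K (WithTop ℤ)) (π : K)
    (hπ : v π = ((1 : ℤ) : WithTop ℤ)) (φ : K[X]) (hφ : IsEisenstein v φ)
    (hn : 0 < φ.natDegree) (α : AlgebraicClosure K) (hα : aeval α φ = 0) :
    minpoly K α = φ := by
  obtain ⟨B, hg0, hg1, hw⟩ := exists_w (E := AlgebraicClosure K) v π hπ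
  have hdvd : minpoly K α ∣ φ := minpoly.dvd K α hα
  have hint : IsIntegral K α := Algebra.IsIntegral.isIntegral α
  obtain ⟨a, ha, haM⟩ := norm_val v π hπ B hg0 hg1 hw α X φ.natDegree hn 1 (by
      intro β hβ
      have := (root_val B.valuation v _ hg0 hg1 hw _ hφ hn β
        (aeval_eq_zero_of_dvd_aeval_eq_zero hdvd hβ)).1
      rw [aeval_X, this, zpow_one])
  have hd : φ.natDegree ≤ (minpoly K α).natDegree := by
    apply Nat.le_of_dvd (minpoly.natDegree_pos hint)
    rw [← Int.natCast_dvd_natCast]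
    exact ⟨a, by linarith⟩
  exact (eq_of_monic_of_dvd_of_natDegree_le (minpoly.monic hint) hφ.1 hdvd hd).symm

lemma nsmul_coe (n : ℕ) (m : ℤ) :
    n • ((m : ℤ) : WithTop ℤ) = ((n * m : ℤ) : WithTop ℤ) := by
  rw [← WithTop.coe_nsmul]; simp

lemma v_natCast {K : Type*} [Field K] [CharZero K] (v : AddValuation K (WithTop ℤ)) (n : ℕ)
    (hn : 0 < n) : ∃ N : ℤ, 0 ≤ N ∧ v (n : K) = (N : WithTop ℤ) := by
  have h : ∀ k : ℕ, 0 ≤ v (k : K) := by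
    intro k
    induction k with
    | zero => simp
    | succ k ih => push_cast; exact v.map_le_add ih (by simp)
  rcases v_cases v (n : K) with h0 | ⟨m, hm⟩
  · exact absurd h0 (by exact_mod_cast hn.ne')
  · refine ⟨m, ?_, hm⟩
    have := h n
    rw [hm] at this
    exact_mod_cast this

lemma eq_of_euclid (n : ℤ) (a a' b b' : ℤ) (hb : 0 ≤ b) (hbn : b < n) (hb' : 0 ≤ b')
    (hbn' : b' < n) (h : a * n + b = a' * n + b') : a = a' ∧ b = b' := by
  have e1 : (a * n + b) % n = b := by
    rw [Int.mul_add_emod_self_right, Int.emod_eq_of_lt hb hbn]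
  have e2 : (a' * n + b') % n = b' := by
    rw [Int.mul_add_emod_self_right, Int.emod_eq_of_lt hb' hbn']
  have hbb : b = b' := by rw [← e1, h, e2]
  refine ⟨?_, hbb⟩
  subst hbb
  exact mul_right_cancel₀ (by omega : n ≠ 0) (add_right_cancel h)

lemma forward {K : Type*} [Field K] [CharZero K] (v : AddValuation K (WithTop ℤ)) (π : K)
    (hπ : v π = ((1 : ℤ) : WithTop ℤ)) (n : ℕ) (hn : 0 < n) (J0 a0 : ℤ) (b0 : ℕ)
    (hb0 : (b0 : ℤ) < n) (hJ0 : J0 = a0 * n + b0) (α : AlgebraicClosure K)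
    (hdeg : (minpoly K α).natDegree = n) (hE : IsEisenstein v (minpoly K α))
    (hd : v (Algebra.discr K
            (fun i : Fin n => (IntermediateField.AdjoinSimple.gen K α) ^ (i : ℕ))) =
          (((n : ℤ) + J0 - 1 : ℤ) : WithTop ℤ)) :
    (min (n • v ((b0 : K))) (n • v ((n : K))) ≤ (J0 : WithTop ℤ) ∧
        (J0 : WithTop ℤ) ≤ n • v ((n : K))) := by
  obtain ⟨N, hN0, hN⟩ := v_natCast v n hn
  have hcn : (minpoly K α).coeff n = 1 := by rw [← hdeg]; exact hE.1
  obtain ⟨k, hk, hkmin⟩ := Finset.exists_min_image (Finset.Icc 1 n)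
    (fun i : ℕ => n • v ((i : K) * (minpoly K α).coeff i) + ((i : ℤ) : WithTop ℤ))
    ⟨n, by simp; omega⟩
  rw [Finset.mem_Icc] at hk
  have hvn : v ((n : K) * (minpoly K α).coeff n) = (N : WithTop ℤ) := by rw [hcn, mul_one, hN]
  have hkn := hkmin n (by simp; omega)
  rcases v_cases v ((k : K) * (minpoly K α).coeff k) with h0 | ⟨m, hm⟩
  · rw [h0, hvn, v.map_zero, nsmul_coe] at hkn
    have : n • (⊤ : WithTop ℤ) = ⊤ := by
      obtain ⟨l, rfl⟩ : ∃ l, n = l + 1 := ⟨n - 1, by omega⟩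
      rw [succ_nsmul, WithTop.add_top]
    rw [this, WithTop.top_add, top_le_iff] at hkn
    exact absurd hkn (by rw [← WithTop.coe_add]; exact WithTop.coe_ne_top)
  have hmin : ∀ i, 1 ≤ i → i ≤ n → ∀ a : ℤ, v ((i : K) * (minpoly K α).coeff i) = (a : WithTop ℤ) →
      n * m + k ≤ n * a + i := by
    intro i hi1 hin a ha
    have := hkmin i (by simp; omega)
    rw [ha, hm, nsmul_coe, nsmul_coe] at this
    exact_mod_cast this
  have hkey := discr_val v π hπ α n hn hdeg hE k hk.1 hk.2 m hm hmin
  rw [hd] at hkey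
  have hkey : (n : ℤ) + J0 - 1 = n * m + k - 1 := WithTop.coe_injective hkey
  have hup := hmin n hn le_rfl N hvn
  rw [hN, nsmul_coe]
  have hup' : J0 ≤ n * N := by linarith
  refine ⟨?_, by exact_mod_cast hup'⟩
  rcases hk.2.eq_or_lt with hkn | hkn
  · apply min_le_of_right_le
    subst hkn
    rw [hvn] at hm
    have : N = m := WithTop.coe_injective hm
    have : (k : ℤ) * N ≤ J0 := by rw [this]; linarith
    exact_mod_cast this
  · apply min_le_of_left_le
    obtain ⟨e1, e2⟩ := eq_of_euclid n a0 (m - 1) b0 k (by omega) hb0 (by omega) (by omega)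
      (by rw [← hJ0]; linarith)
    have e2 : b0 = k := by exact_mod_cast e2
    subst e2
    obtain ⟨c, hc0, hc⟩ := v_natCast v b0 hk.1
    have hφ := hE.2.1 b0 (by omega)
    rw [v.map_mul, hc] at hm
    rw [hc, nsmul_coe]
    cases hv : v ((minpoly K α).coeff b0) with
    | top => rw [hv] at hm; simp at hm
    | coe d =>
      rw [hv] at hm hφ
      norm_cast at hm hφ ⊢
      have : c ≤ a0 := by omega
      have := mul_le_mul_of_nonneg_left this (by omega : (0 : ℤ) ≤ n)
      rw [hJ0]
      linarith

lemma construct {K : Type*} [Field K] [CharZero K] (v : AddValuation K (WithTop ℤ)) (π : K)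
    (hπ : v π = ((1 : ℤ) : WithTop ℤ)) (n : ℕ) (hn : 0 < n) (b : ℕ) (hb : b < n) (c : K)
    (hc : ((1 : ℤ) : WithTop ℤ) ≤ v c) (hbc : b = 0 → c = 0) :
    ∃ α : AlgebraicClosure K, IsEisenstein v (minpoly K α) ∧
      minpoly K α = X ^ n + (C c * X ^ b + C π) := by
  have hdeg : (C c * X ^ b + C π).degree < (n : WithBot ℕ) := by
    refine lt_of_le_of_lt (degree_add_le _ _) (max_lt ?_ ?_)
    · exact lt_of_le_of_lt (degree_C_mul_X_pow_le _ _) (by exact_mod_cast hb)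
    · exact lt_of_le_of_lt degree_C_le (by exact_mod_cast hn)
  have hm : (X ^ n + (C c * X ^ b + C π)).Monic := monic_X_pow_add hdeg
  have hnd : (X ^ n + (C c * X ^ b + C π)).natDegree = n := by
    apply natDegree_eq_of_degree_eq_some
    rw [degree_add_eq_left_of_degree_lt] <;> simp [hdeg]
  have hE : IsEisenstein v (X ^ n + (C c * X ^ b + C π)) := by
    refine ⟨hm, ?_, ?_⟩
    · intro i hi
      rw [hnd] at hi
      simp only [coeff_add, coeff_X_pow, coeff_C_mul, coeff_C, hi.ne, if_false, zero_add]
      apply v.map_le_add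
      · split_ifs
        · rw [mul_one]; exact hc
        · simp
      · split_ifs <;> simp [hπ]
    · by_cases h : b = 0
      · simp [coeff_X_pow, hn.ne, hn.ne', hbc h, hπ]
      · simp [coeff_X_pow, hn.ne, hn.ne', h, Ne.symm h, hπ]
  obtain ⟨α, hα⟩ := IsAlgClosed.exists_aeval_eq_zero (AlgebraicClosure K)
    (X ^ n + (C c * X ^ b + C π)) (by
      rw [degree_eq_natDegree hm.ne_zero, hnd]; exact_mod_cast hn.ne')
  have := minpoly_eq v π hπ _ hE (by omega) α hα
  exact ⟨α, this ▸ hE, this⟩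

lemma backward {K : Type*} [Field K] [CharZero K] (v : AddValuation K (WithTop ℤ)) (π : K)
    (hπ : v π = ((1 : ℤ) : WithTop ℤ)) (n : ℕ) (hn : 0 < n) (J0 a0 : ℤ) (b0 : ℕ)
    (hb0 : (b0 : ℤ) < n) (hJ0 : J0 = a0 * n + b0)
    (h : min (n • v ((b0 : K))) (n • v ((n : K))) ≤ (J0 : WithTop ℤ) ∧
        (J0 : WithTop ℤ) ≤ n • v ((n : K))) :
    ∃ α : AlgebraicClosure K,
        (minpoly K α).natDegree = n ∧ IsEisenstein v (minpoly K α) ∧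
        v (Algebra.discr K
            (fun i : Fin n => (IntermediateField.AdjoinSimple.gen K α) ^ (i : ℕ))) =
          (((n : ℤ) + J0 - 1 : ℤ) : WithTop ℤ) := by
  obtain ⟨N, hN0, hN⟩ := v_natCast v n hn
  obtain ⟨h1, h2⟩ := h
  rw [hN, nsmul_coe] at h1 h2
  have h2 : J0 ≤ n * N := by exact_mod_cast h2
  have hnat : ∀ (c : K) (b : ℕ), b < n → (X ^ n + (C c * X ^ b + C π)).natDegree = n := by
    intro c b hb
    have hdeg : (C c * X ^ b + C π).degree < (n : WithBot ℕ) := by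
      refine lt_of_le_of_lt (degree_add_le _ _) (max_lt ?_ ?_)
      · exact lt_of_le_of_lt (degree_C_mul_X_pow_le _ _) (by exact_mod_cast hb)
      · exact lt_of_le_of_lt degree_C_le (by exact_mod_cast hn)
    apply natDegree_eq_of_degree_eq_some
    rw [degree_add_eq_left_of_degree_lt] <;> simp [hdeg]
  have hcoef : ∀ (c : K) (b i : ℕ), 1 ≤ i → (X ^ n + (C c * X ^ b + C π)).coeff i =
      (if i = n then 1 else 0) + (if i = b then c else 0) := by
    intro c b i hi
    simp [coeff_X_pow, coeff_C, show i ≠ 0 by omega]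
  rcases Nat.eq_zero_or_pos b0 with hb | hb
  · subst hb
    have hJN : J0 = n * N := by
      apply le_antisymm h2
      rcases min_le_iff.1 h1 with h | h
      · rw [Nat.cast_zero, v.map_zero] at h
        have ht : n • (⊤ : WithTop ℤ) = ⊤ := by
          obtain ⟨l, rfl⟩ : ∃ l, n = l + 1 := ⟨n - 1, by omega⟩
          rw [succ_nsmul, WithTop.add_top]
        rw [ht, top_le_iff] at h
        exact absurd h WithTop.coe_ne_top
      · exact_mod_cast h
    obtain ⟨α, hE, hα⟩ := construct v π hπ n hn 0 hn 0 (by simp) (fun _ => rfl)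
    have hdeg : (minpoly K α).natDegree = n := by rw [hα]; exact hnat 0 0 hn
    refine ⟨α, hdeg, hE, ?_⟩
    rw [discr_val v π hπ α n hn hdeg hE n hn le_rfl N]
    · congr 1; rw [hJN]; ring
    · rw [hα, hcoef _ _ _ hn]
      simp [hn.ne', hN]
    · intro i hi hin a ha
      rw [hα, hcoef _ _ _ hi] at ha
      by_cases hi' : i = n
      · subst hi'
        simp only [if_true, ite_self, add_zero, mul_one, hN] at ha
        have : N = a := WithTop.coe_injective ha
        rw [this]
      · simp [hi'] at ha
  · obtain ⟨s, hs0, hs⟩ := v_natCast v b0 hb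
    have hbn : b0 < n := by exact_mod_cast hb0
    rw [hs, nsmul_coe] at h1
    have hJs : n * s ≤ J0 := by
      rcases min_le_iff.1 h1 with h | h
      · exact_mod_cast h
      · have h : n * N ≤ J0 := by exact_mod_cast h
        have := (eq_of_euclid n a0 N b0 0 (by omega) hb0 le_rfl (by omega)
          (by rw [← hJ0]; linarith)).2
        omega
    have hsa : s ≤ a0 := by
      by_contra hlt
      have : a0 + 1 ≤ s := by omega
      have := mul_le_mul_of_nonneg_left this (by omega : (0 : ℤ) ≤ n)
      linarith
    have hvc := v_zpow v π hπ (a0 - s + 1)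
    obtain ⟨α, hE, hα⟩ := construct v π hπ n hn b0 hbn (π ^ (a0 - s + 1))
      (by rw [hvc]; exact_mod_cast (by omega : 1 ≤ a0 - s + 1)) (by omega)
    have hdeg : (minpoly K α).natDegree = n := by rw [hα]; exact hnat _ _ hbn
    refine ⟨α, hdeg, hE, ?_⟩
    have hvb : v ((b0 : K) * (minpoly K α).coeff b0) = ((a0 + 1 : ℤ) : WithTop ℤ) := by
      rw [hα, hcoef _ _ _ hb, if_neg hbn.ne, if_pos rfl, zero_add, v.map_mul, hs, hvc,
        ← WithTop.coe_add]
      congr 1; ring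
    rw [discr_val v π hπ α n hn hdeg hE b0 hb hbn.le (a0 + 1) hvb]
    · congr 1; rw [hJ0]; ring
    · intro i hi hin a ha
      by_cases hib : i = b0
      · subst hib
        rw [hvb] at ha
        have : a0 + 1 = a := WithTop.coe_injective ha
        rw [this]
      rw [hα, hcoef _ _ _ hi] at ha
      by_cases hi' : i = n
      · subst hi'
        simp only [if_true, if_neg hib, add_zero, mul_one, hN] at ha
        have : N = a := WithTop.coe_injective ha
        rw [← this]
        linarith
      · simp [hi', hib] at ha

end RamificationStmt0

open RamificationStmt0 in
/-- **Ore's conditions.** Let `K` be a finite extension of `ℚ_p`, `n` a positive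
integer and `J₀ = a₀n + b₀` with `0 ≤ b₀ < n`.  There exists a totally ramified extension `L/K`
of degree `n` with discriminant `(π)^(n+J₀−1)` (equivalently, an `α` in a fixed algebraic closure
of `K` whose minimal polynomial is Eisenstein of degree `n` -- so that `L = K(α)` is totally
ramified of degree `n` -- whose power basis has discriminant of valuation `n + J₀ − 1`) if and
only if `min{v_π(b₀)·n, v_π(n)·n} ≤ J₀ ≤ v_π(n)·n`, with the convention `v_π(0) = ∞` (i.e. in
`WithTop ℤ`). -/
theorem stmt0 {p : ℕ} [Fact p.Prime] {K : Type*} [Field K]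
    [Algebra ℚ_[p] K] [FiniteDimensional ℚ_[p] K]
    [Algebra ℤ_[p] K] [IsScalarTower ℤ_[p] ℚ_[p] K]
    (v : AddValuation K (WithTop ℤ)) (π : K) (hπ : v π = ((1 : ℤ) : WithTop ℤ))
    (hv : ∀ x : K, 0 ≤ v x ↔ IsIntegral ℤ_[p] x)
    (n : ℕ) (hn : 0 < n) (J0 a0 : ℤ) (b0 : ℕ) (hb0 : (b0 : ℤ) < n)
    (hJ0 : J0 = a0 * n + b0) :
    (∃ α : AlgebraicClosure K,
        (minpoly K α).natDegree = n ∧ IsEisenstein v (minpoly K α) ∧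
        v (Algebra.discr K
            (fun i : Fin n => (IntermediateField.AdjoinSimple.gen K α) ^ (i : ℕ))) =
          (((n : ℤ) + J0 - 1 : ℤ) : WithTop ℤ)) ↔
      (min (n • v ((b0 : K))) (n • v ((n : K))) ≤ (J0 : WithTop ℤ) ∧
        (J0 : WithTop ℤ) ≤ n • v ((n : K))) := by
  have : CharZero K := charZero_of_injective_algebraMap (algebraMap ℚ_[p] K).injective
  constructor
  · rintro ⟨α, hdeg, hE, hd⟩
    exact forward v π hπ n hn J0 a0 b0 hb0 hJ0 α hdeg hE hd
  · exact backward v π hπ n hn J0 a0 b0 hb0 hJ0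
end

section
/- Every totally ramified extension L/K of degree n with discriminant (π)^{n+J_0−1}, where J_0 = a_0·n + b_0 with 0 ≤ b_0 < n, can be generated by an Eisenstein polynomial φ ∈ O_K[x] whose π-adic coefficient digits satisfy φ_{i,j} = 0 for all 0 ≤ i < n and all j > 1 + 2a_0 + 2b_0/n. -/
open Polynomial IntermediateField

namespace RamificationStmt2

def IsEisenstein {K : Type*} [Field K] (v : AddValuation K (WithTop ℤ)) (φ : Polynomial K) :
    Prop :=
  φ.Monic ∧ (∀ i < φ.natDegree, ((1 : ℤ) : WithTop ℤ) ≤ v (φ.coeff i)) ∧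
    v (φ.coeff 0) = ((1 : ℤ) : WithTop ℤ)

end RamificationStmt2

namespace RamificationStmt2

section core

set_option linter.unusedSectionVars false

variable {K Ω : Type*} [Field K] [NormedField Ω] [IsUltrametricDist Ω] [Algebra K Ω]

theorem norm_sub_le_of_le {x y : Ω} {c : ℝ} (hx : ‖x‖ ≤ c) (hy : ‖y‖ ≤ c) : ‖x - y‖ ≤ c := by
  have := IsUltrametricDist.norm_add_le_max x (-y)
  rw [← sub_eq_add_neg, norm_neg] at this
  exact this.trans (max_le hx hy)

theorem norm_multiset_prod_map (S : Multiset Ω) (f : Ω → Ω) :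
    ‖(S.map f).prod‖ = (S.map fun a => ‖f a‖).prod := by
  induction S using Multiset.induction_on with
  | empty => simp
  | cons a s ih => simp [ih]

theorem multiset_prod_le_pow (S : Multiset Ω) (f : Ω → ℝ) (c : ℝ) (h0 : ∀ a ∈ S, 0 ≤ f a)
    (h : ∀ a ∈ S, f a ≤ c) (hc : 0 ≤ c) : (S.map f).prod ≤ c ^ S.card := by
  induction S using Multiset.induction_on with
  | empty => simp
  | cons a s ih =>
    simp only [Multiset.map_cons, Multiset.prod_cons, Multiset.card_cons, pow_succ']
    refine mul_le_mul (h a (by simp)) (ih (fun b hb => h0 b (by simp [hb]))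
      (fun b hb => h b (by simp [hb]))) ?_ hc
    refine Multiset.prod_nonneg ?_
    intro x hx
    obtain ⟨b, hb, rfl⟩ := Multiset.mem_map.mp hx
    exact h0 b (by simp [hb])

/-- the derivative of the minimal polynomial at a root -/
theorem deriv_eq_prod [IsAlgClosed Ω] (α : Ω) (f : K[X]) (hf : f.Monic) (hα : aeval α f = 0) :
    ∃ S : Multiset Ω, S.card + 1 = f.natDegree ∧ (∀ a ∈ S, aeval a f = 0) ∧
      aeval α f.derivative = (S.map fun a => α - a).prod ∧
      (∀ a, aeval a f = 0 → a ≠ α → a ∈ S) := by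
  classical
  have hs := IsAlgClosed.splits (f.map (algebraMap K Ω))
  have hm : (f.map (algebraMap K Ω)).Monic := hf.map _
  have hmem : ∀ a, a ∈ (f.map (algebraMap K Ω)).roots ↔ aeval a f = 0 := by
    intro a
    rw [mem_roots hm.ne_zero, IsRoot.def, eval_map_algebraMap]
  refine ⟨(f.map (algebraMap K Ω)).roots.erase α, ?_, ?_, ?_, ?_⟩
  · rw [Multiset.card_erase_add_one ((hmem α).2 hα), ← hs.natDegree_eq_card_roots,
      natDegree_map]
  · intro a ha
    exact (hmem a).1 (Multiset.mem_of_mem_erase ha)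
  · rw [← eval_multiset_prod_X_sub_C_derivative ((hmem α).2 hα),
      ← hs.eq_prod_roots_of_monic hm, derivative_map, eval_map_algebraMap]
  · intro a ha hne
    exact (Multiset.mem_erase_of_ne hne).2 ((hmem a).2 ha)

/-- approximate roots -/
theorem exists_close_root [IsAlgClosed Ω] (α : Ω) (f : K[X]) (hf : f.Monic)
    (hd : 0 < f.natDegree) :
    ∃ β : Ω, aeval β f = 0 ∧ ‖α - β‖ * ‖aeval α f.derivative‖ ≤ ‖aeval α f‖ := by
  classical
  have hs := IsAlgClosed.splits (f.map (algebraMap K Ω))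
  have hm : (f.map (algebraMap K Ω)).Monic := hf.map _
  set S := (f.map (algebraMap K Ω)).roots with hS
  have hmem : ∀ a, a ∈ S ↔ aeval a f = 0 := by
    intro a
    rw [mem_roots hm.ne_zero, IsRoot.def, eval_map_algebraMap]
  have hcard : S.card = f.natDegree := by
    rw [hS, ← hs.natDegree_eq_card_roots, natDegree_map]
  have hev : aeval α f = (S.map fun a => α - a).prod := by
    rw [← eval_map_algebraMap, hs.eq_prod_roots_of_monic hm, eval_multiset_prod]
    simp [hS]
  have hder : aeval α f.derivative =
      (S.map fun a => ((S.erase a).map fun b => α - b).prod).sum := by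
    rw [← eval_map_algebraMap, ← derivative_map, hs.eq_prod_roots_of_monic hm, derivative_prod,
      ← coe_evalRingHom, map_multiset_sum, Multiset.map_map]
    congr 1
    refine Multiset.map_congr rfl ?_
    intro a _
    simp [eval_multiset_prod, hS]
  obtain ⟨β, hβ, hle⟩ := IsUltrametricDist.exists_norm_multiset_sum_le S
    (f := fun a => ((S.erase a).map fun b => α - b).prod)
  have hβS : β ∈ S := hβ (by rw [← Multiset.card_pos, hcard]; exact hd)
  refine ⟨β, (hmem β).1 hβS, ?_⟩
  rw [hder, hev]
  calc _ ≤ ‖α - β‖ * ‖((S.erase β).map fun b => α - b).prod‖ := by gcongr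
    _ = _ := by
      rw [← norm_mul, ← Multiset.prod_cons, ← Multiset.map_cons (fun b => α - b),
        Multiset.cons_erase hβS]

theorem krasner_aux [CharZero K] [IsAlgClosed Ω] [Algebra.IsAlgebraic K Ω]
    (hinv : ∀ x y : Ω, IsConjRoot K x y → ‖x‖ = ‖y‖) (α β : Ω)
    (h : ∀ α' : Ω, aeval α' (minpoly K α) = 0 → α' ≠ α → ‖α - β‖ < ‖α - α'‖) :
    α ∈ K⟮β⟯ := by
  by_contra hn
  have hint : IsIntegral K α := Algebra.IsIntegral.isIntegral α
  have hint' : IsIntegral K⟮β⟯ α := hint.tower_top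
  have hn' : α ∉ (⊥ : Subalgebra K⟮β⟯ Ω) := by
    simpa [Algebra.mem_bot] using hn
  have hsep : IsSeparable K⟮β⟯ α := (minpoly.irreducible hint').separable
  obtain ⟨α', hne, hc⟩ := (notMem_iff_exists_ne_and_isConjRoot hsep
    (IsAlgClosed.splits _)).mp hn'
  have hc2 : IsConjRoot K⟮β⟯ (α - β) (α' - β) := by
    simpa using hc.sub_algebraMap (AdjoinSimple.gen K β)
  have h1 := hinv _ _ (hc2.of_isScalarTower (K := K) (Algebra.IsIntegral.isIntegral _))
  have h2 := h α' ((hc.of_isScalarTower (K := K) hint).aeval_eq_zero) hne.symm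
  have h3 : ‖(α - β) - (α' - β)‖ ≤ ‖α - β‖ := norm_sub_le_of_le le_rfl h1.symm.le
  rw [show (α - β) - (α' - β) = α - α' by ring] at h3
  linarith

theorem aeval_norm_le (g : K[X]) (α : Ω) (hα : ‖α‖ ≤ 1) {c : ℝ} (hc : 0 ≤ c)
    (h : ∀ i, ‖algebraMap K Ω (g.coeff i)‖ ≤ c) : ‖aeval α g‖ ≤ c := by
  rw [aeval_eq_sum_range]
  refine IsUltrametricDist.norm_sum_le_of_forall_le_of_nonneg hc ?_
  intro i _
  rw [Algebra.smul_def, norm_mul, norm_pow]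
  calc _ ≤ c * 1 := mul_le_mul (h i) (pow_le_one₀ (norm_nonneg _) hα) (by positivity) hc
    _ = c := mul_one c

theorem core_bound [IsAlgClosed Ω] [Algebra.IsAlgebraic K Ω]
    (hinv : ∀ x y : Ω, IsConjRoot K x y → ‖x‖ = ‖y‖) (α : Ω) :
    ‖aeval α (minpoly K α).derivative‖ ≤ ‖α‖ ^ ((minpoly K α).natDegree - 1) ∧
    ∀ α' : Ω, aeval α' (minpoly K α) = 0 → α' ≠ α →
      2 ≤ (minpoly K α).natDegree ∧
      ‖aeval α (minpoly K α).derivative‖ ≤ ‖α - α'‖ * ‖α‖ ^ ((minpoly K α).natDegree - 2) := by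
  have hint : IsIntegral K α := Algebra.IsIntegral.isIntegral α
  obtain ⟨S, hcard, hroot, hder, hmem⟩ := deriv_eq_prod α (minpoly K α) (minpoly.monic hint)
    (minpoly.aeval K α)
  have hb : ∀ a ∈ S, ‖α - a‖ ≤ ‖α‖ := fun a ha =>
    norm_sub_le_of_le le_rfl (hinv _ _ (isConjRoot_of_aeval_eq_zero hint (hroot a ha))).symm.le
  constructor
  · rw [hder, norm_multiset_prod_map, show (minpoly K α).natDegree - 1 = S.card by omega]
    exact multiset_prod_le_pow S _ _ (fun _ _ => norm_nonneg _) hb (norm_nonneg _)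
  · intro α' h1 h2
    obtain ⟨T, rfl⟩ := Multiset.exists_cons_of_mem (hmem α' h1 h2)
    rw [Multiset.card_cons] at hcard
    refine ⟨by omega, ?_⟩
    rw [hder, norm_multiset_prod_map, show (minpoly K α).natDegree - 2 = T.card by omega,
      Multiset.map_cons, Multiset.prod_cons]
    gcongr
    exact multiset_prod_le_pow T _ _ (fun _ _ => norm_nonneg _)
      (fun a ha => hb a (by simp [ha])) (norm_nonneg _)

theorem core [CharZero K] [IsAlgClosed Ω] [Algebra.IsAlgebraic K Ω]
    (hinv : ∀ x y : Ω, IsConjRoot K x y → ‖x‖ = ‖y‖) (α : Ω) (h0 : 0 < ‖α‖) (h1 : ‖α‖ < 1)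
    (n J : ℕ) (hn : 0 < n) (hdeg : (minpoly K α).natDegree = n)
    (hder : ‖aeval α (minpoly K α).derivative‖ = ‖α‖ ^ (n + J - 1))
    (ψ : K[X]) (hψ : ψ.Monic) (hψn : ψ.natDegree = n)
    (hclose : ∀ i, ‖algebraMap K Ω ((ψ - minpoly K α).coeff i)‖ ≤ ‖α‖ ^ (n + 2 * J + 1)) :
    ∃ β : Ω, K⟮β⟯ = K⟮α⟯ ∧ minpoly K β = ψ := by
  have hint : IsIntegral K α := Algebra.IsIntegral.isIntegral α
  have e1 : ‖aeval α ψ‖ ≤ ‖α‖ ^ (n + 2 * J + 1) := by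
    have := aeval_norm_le (ψ - minpoly K α) α h1.le (by positivity) hclose
    simpa using this
  have e2 : ‖aeval α (ψ - minpoly K α).derivative‖ ≤ ‖α‖ ^ (n + 2 * J + 1) := by
    refine aeval_norm_le _ α h1.le (by positivity) ?_
    intro i
    rw [coeff_derivative, map_mul, norm_mul]
    have : ‖algebraMap K Ω ((i : K) + 1)‖ ≤ 1 := by
      have := IsUltrametricDist.norm_natCast_le_one Ω (i + 1)
      simpa using this
    calc _ ≤ ‖α‖ ^ (n + 2 * J + 1) * 1 :=
          mul_le_mul (hclose _) this (norm_nonneg _) (by positivity)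
      _ = _ := mul_one _
  have e3 : ‖α‖ ^ (n + J - 1) ≤ ‖aeval α ψ.derivative‖ := by
    by_contra hlt
    push Not at hlt
    have h3 : ‖α‖ ^ (n + 2 * J + 1) < ‖α‖ ^ (n + J - 1) :=
      pow_lt_pow_right_of_lt_one₀ h0 h1 (by omega)
    have h4 : ‖aeval α ψ.derivative - aeval α (ψ - minpoly K α).derivative‖ ≤
        max ‖aeval α ψ.derivative‖ (‖α‖ ^ (n + 2 * J + 1)) :=
      norm_sub_le_of_le (le_max_left _ _) (e2.trans (le_max_right _ _))
    have h5 : aeval α ψ.derivative - aeval α (ψ - minpoly K α).derivative =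
        aeval α (minpoly K α).derivative := by
      simp
    rw [h5, hder] at h4
    exact absurd h4 (not_le.2 (max_lt hlt h3))
  obtain ⟨β, hβ, hle⟩ := exists_close_root α ψ hψ (by omega)
  have e4 : ‖α - β‖ ≤ ‖α‖ ^ (J + 2) := by
    have hp : 0 < ‖α‖ ^ (n + J - 1) := by positivity
    refine le_of_mul_le_mul_right ?_ hp
    rw [← pow_add, show J + 2 + (n + J - 1) = n + 2 * J + 1 by omega]
    calc _ ≤ ‖α - β‖ * ‖aeval α ψ.derivative‖ := by gcongr
      _ ≤ _ := hle.trans e1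
  have hmem : α ∈ K⟮β⟯ := by
    refine krasner_aux hinv α β ?_
    intro α' ha hne
    obtain ⟨h2, hb⟩ := (core_bound hinv α).2 α' ha hne
    rw [hder, hdeg] at hb
    rw [hdeg] at h2
    refine e4.trans_lt ?_
    have h6 : ‖α‖ ^ (J + 2) < ‖α‖ ^ (J + 1) := pow_lt_pow_right_of_lt_one₀ h0 h1 (by omega)
    refine h6.trans_le ?_
    have hp : 0 < ‖α‖ ^ (n - 2) := by positivity
    refine le_of_mul_le_mul_right ?_ hp
    rw [← pow_add, show J + 1 + (n - 2) = n + J - 1 by omega]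
    exact hb
  have hintβ : IsIntegral K β := Algebra.IsIntegral.isIntegral β
  have hle' : K⟮α⟯ ≤ K⟮β⟯ := by
    rw [adjoin_simple_le_iff]; exact hmem
  have : FiniteDimensional K K⟮β⟯ := adjoin.finiteDimensional hintβ
  have hdvd : minpoly K β ∣ ψ := minpoly.dvd K β hβ
  have hdle : (minpoly K β).natDegree ≤ n := hψn ▸ natDegree_le_of_dvd hdvd hψ.ne_zero
  have heq : K⟮α⟯ = K⟮β⟯ := by
    refine IntermediateField.eq_of_le_of_finrank_le hle' ?_
    rw [adjoin.finrank hint, adjoin.finrank hintβ, hdeg]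
    exact hdle
  refine ⟨β, heq.symm, ?_⟩
  have hd : (minpoly K β).natDegree = n := by
    rw [← adjoin.finrank hintβ, ← heq, adjoin.finrank hint, hdeg]
  exact (eq_of_monic_of_dvd_of_natDegree_le (minpoly.monic hintβ) hψ hdvd (by omega)).symm

theorem norm_algebra_norm [CharZero K] [IsAlgClosed Ω] [Algebra.IsAlgebraic K Ω]
    (hinv : ∀ x y : Ω, IsConjRoot K x y → ‖x‖ = ‖y‖) (α : Ω) (x : K⟮α⟯) :
    ‖algebraMap K Ω (Algebra.norm K x)‖ = ‖(x : Ω)‖ ^ (minpoly K α).natDegree := by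
  have hint : IsIntegral K α := Algebra.IsIntegral.isIntegral α
  have : FiniteDimensional K K⟮α⟯ := adjoin.finiteDimensional hint
  rw [Algebra.norm_eq_prod_embeddings, norm_prod]
  have : ∀ σ ∈ (Finset.univ : Finset (K⟮α⟯ →ₐ[K] Ω)), ‖σ x‖ = ‖(x : Ω)‖ := by
    intro σ _
    refine hinv _ _ ?_
    rw [isConjRoot_def, minpoly.algHom_eq σ σ.injective]
    exact (minpoly.algHom_eq (K⟮α⟯.val) K⟮α⟯.val.injective x).symm
  rw [Finset.prod_congr rfl this, Finset.prod_const, Finset.card_univ, AlgHom.card,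
    adjoin.finrank hint]

theorem discr_norm [CharZero K] [IsAlgClosed Ω] [Algebra.IsAlgebraic K Ω]
    (hinv : ∀ x y : Ω, IsConjRoot K x y → ‖x‖ = ‖y‖) (α : Ω) (n : ℕ)
    (hdeg : (minpoly K α).natDegree = n) :
    ‖algebraMap K Ω ((minpoly K α).coeff 0)‖ = ‖α‖ ^ n ∧
    ‖algebraMap K Ω (Algebra.discr K (fun i : Fin n => (AdjoinSimple.gen K α) ^ (i : ℕ)))‖ =
      ‖aeval α (minpoly K α).derivative‖ ^ n := by
  have hint : IsIntegral K α := Algebra.IsIntegral.isIntegral α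
  have : FiniteDimensional K K⟮α⟯ := adjoin.finiteDimensional hint
  subst hdeg
  have hg : minpoly K (AdjoinSimple.gen K α) = minpoly K α := minpoly_gen K α
  constructor
  · have h1 := Algebra.PowerBasis.norm_gen_eq_coeff_zero_minpoly (adjoin.powerBasis hint)
    rw [adjoin.powerBasis_gen, hg] at h1
    have h2 := norm_algebra_norm hinv α (AdjoinSimple.gen K α)
    rw [h1] at h2
    simpa using h2
  · have h1 := Algebra.discr_powerBasis_eq_norm K (adjoin.powerBasis hint)
    rw [PowerBasis.coe_basis] at h1
    rw [adjoin.powerBasis_gen, hg] at h1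
    have h3 : Algebra.discr K (fun i : Fin (minpoly K α).natDegree =>
        (AdjoinSimple.gen K α) ^ (i : ℕ)) =
      Algebra.discr K (fun i : Fin (adjoin.powerBasis hint).dim =>
        (AdjoinSimple.gen K α) ^ (i : ℕ)) := rfl
    rw [h3, h1, map_mul, norm_mul, norm_algebra_norm hinv]
    have h4 : ((aeval (AdjoinSimple.gen K α) (minpoly K α).derivative : K⟮α⟯) : Ω) =
        aeval α (minpoly K α).derivative := by
      have := aeval_algebraMap_apply Ω (AdjoinSimple.gen K α) (minpoly K α).derivative
      simp [this]
    rw [h4]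
    simp

end core

end RamificationStmt2

namespace RamificationStmt2

section val

variable {K : Type*} [Field K] (v : AddValuation K (WithTop ℤ)) (π : K)
  (hπ : v π = ((1 : ℤ) : WithTop ℤ))

theorem val_pi_ne_zero (hπ : v π = ((1 : ℤ) : WithTop ℤ)) : π ≠ 0 := by
  rintro rfl
  rw [AddValuation.map_zero] at hπ
  exact WithTop.top_ne_coe hπ

theorem val_inv {x : K} {k : ℤ} (hx : v x = (k : WithTop ℤ)) : v x⁻¹ = ((-k : ℤ) : WithTop ℤ) := by
  have h0 : x ≠ 0 := by
    rintro rfl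
    rw [AddValuation.map_zero] at hx
    exact WithTop.top_ne_coe hx
  have h1 : v x + v x⁻¹ = 0 := by
    rw [← AddValuation.map_mul, mul_inv_cancel₀ h0, AddValuation.map_one]
  obtain ⟨m, hm⟩ := WithTop.ne_top_iff_exists.1 ((v.ne_top_iff).2 (inv_ne_zero h0))
  rw [hx, ← hm] at h1
  rw [← hm]
  have h2 : k + m = 0 := by exact_mod_cast h1
  have h3 : m = -k := by omega
  rw [h3]

theorem val_zpow (hπ : v π = ((1 : ℤ) : WithTop ℤ)) (k : ℤ) : v (π ^ k) = (k : WithTop ℤ) := by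
  have h0 := val_pi_ne_zero v π hπ
  have hnat : ∀ m : ℕ, v (π ^ m) = ((m : ℤ) : WithTop ℤ) := by
    intro m
    induction m with
    | zero => simp
    | succ m ih => rw [pow_succ, AddValuation.map_mul, ih, hπ]; push_cast; rfl
  obtain ⟨m, rfl | rfl⟩ := k.eq_nat_or_neg
  · rw [zpow_natCast, hnat]
  · rw [zpow_neg, zpow_natCast, val_inv v (hnat m)]

theorem val_ge_iff (hπ : v π = ((1 : ℤ) : WithTop ℤ)) (k : ℤ) (x : K) :
    (k : WithTop ℤ) ≤ v x ↔ 0 ≤ v (x * π ^ (-k)) := by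
  rw [AddValuation.map_mul, val_zpow v π hπ]
  by_cases hx : v x = ⊤
  · simp [hx]
  · obtain ⟨m, hm⟩ := WithTop.ne_top_iff_exists.1 hx
    rw [← hm]
    norm_cast
    omega

theorem exists_digits (hπ : v π = ((1 : ℤ) : WithTop ℤ)) (R : Set K) (hR0 : (0 : K) ∈ R)
    (hRrep : ∀ x : K, 0 ≤ v x → ∃ r, r ∈ R ∧ ((1 : ℤ) : WithTop ℤ) ≤ v (x - r))
    (x : K) (hx : 0 ≤ v x) (m : ℕ) :
    ∃ d : ℕ → K, (∀ j, d j ∈ R) ∧ (∀ j, m ≤ j → d j = 0) ∧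
      ((m : ℤ) : WithTop ℤ) ≤ v (x - ∑ j ∈ Finset.range m, d j * π ^ j) := by
  have h0 := val_pi_ne_zero v π hπ
  induction m with
  | zero => exact ⟨fun _ => 0, fun _ => hR0, fun _ _ => rfl, by simpa using hx⟩
  | succ m ih =>
    obtain ⟨d, hd, hd0, hdv⟩ := ih
    obtain ⟨r, hr, hrv⟩ := hRrep _ ((val_ge_iff v π hπ _ _).1 hdv)
    refine ⟨Function.update d m r, ?_, ?_, ?_⟩
    · intro j
      by_cases hj : j = m
      · subst hj; simpa using hr
      · simpa [hj] using hd j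
    · intro j hj
      rw [Function.update_of_ne (by omega)]
      exact hd0 j (by omega)
    · rw [Finset.sum_range_succ, Function.update_self]
      have hs : ∑ j ∈ Finset.range m, Function.update d m r j * π ^ j =
          ∑ j ∈ Finset.range m, d j * π ^ j := by
        refine Finset.sum_congr rfl fun j hj => ?_
        rw [Function.update_of_ne (Finset.mem_range.1 hj).ne]
      rw [hs]
      rw [val_ge_iff v π hπ] at hrv ⊢
      refine hrv.trans_eq ?_
      congr 1
      rw [Nat.cast_succ, neg_add, zpow_add₀ h0, ← mul_assoc]
      congr 1
      rw [← sub_sub, sub_mul _ (r * π ^ m), mul_assoc r, ← zpow_natCast, ← zpow_add₀ h0]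
      simp

variable {Ω : Type*} [NormedField Ω] [Algebra K Ω]

theorem norm_pi_lt (hπ : v π = ((1 : ℤ) : WithTop ℤ))
    (hle : ∀ x : K, 0 ≤ v x ↔ ‖algebraMap K Ω x‖ ≤ 1) :
    0 < ‖algebraMap K Ω π‖ ∧ ‖algebraMap K Ω π‖ < 1 := by
  have h0 := val_pi_ne_zero v π hπ
  have hp : 0 < ‖algebraMap K Ω π‖ := by simpa using h0
  refine ⟨hp, ?_⟩
  have h1 : ¬ (0 ≤ v π⁻¹) := by
    rw [val_inv v hπ]
    norm_cast
  rw [hle, map_inv₀, norm_inv, inv_le_one₀ hp] at h1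
  exact not_le.1 h1

theorem norm_le_of_val (hπ : v π = ((1 : ℤ) : WithTop ℤ))
    (hle : ∀ x : K, 0 ≤ v x ↔ ‖algebraMap K Ω x‖ ≤ 1) {x : K} {k : ℤ}
    (hx : (k : WithTop ℤ) ≤ v x) : ‖algebraMap K Ω x‖ ≤ ‖algebraMap K Ω π‖ ^ k := by
  obtain ⟨hp, -⟩ := norm_pi_lt v π hπ hle
  rw [val_ge_iff v π hπ, hle, map_mul, norm_mul, map_zpow₀, norm_zpow, zpow_neg] at hx
  rwa [← div_eq_mul_inv, div_le_one₀ (zpow_pos hp k)] at hx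

theorem norm_eq_of_val (hπ : v π = ((1 : ℤ) : WithTop ℤ))
    (hle : ∀ x : K, 0 ≤ v x ↔ ‖algebraMap K Ω x‖ ≤ 1) {x : K} {k : ℤ}
    (hx : v x = (k : WithTop ℤ)) : ‖algebraMap K Ω x‖ = ‖algebraMap K Ω π‖ ^ k := by
  obtain ⟨hp, -⟩ := norm_pi_lt v π hπ hle
  have h0 : x ≠ 0 := by
    rintro rfl
    rw [AddValuation.map_zero] at hx
    exact WithTop.top_ne_coe hx
  have hxp : 0 < ‖algebraMap K Ω x‖ := by simpa using h0
  refine le_antisymm (norm_le_of_val v π hπ hle hx.ge) ?_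
  have h1 := norm_le_of_val v π hπ hle (val_inv v hx).ge
  rw [map_inv₀, norm_inv, zpow_neg] at h1
  exact (inv_le_inv₀ hxp (zpow_pos hp k)).1 h1

end val

theorem isIntegral_iff_spectralNorm {p : ℕ} [Fact p.Prime] {K : Type*} [Field K]
    [Algebra ℚ_[p] K] [FiniteDimensional ℚ_[p] K]
    [Algebra ℤ_[p] K] [IsScalarTower ℤ_[p] ℚ_[p] K] (x : K) :
    IsIntegral ℤ_[p] x ↔ spectralNorm ℚ_[p] K x ≤ 1 := by
  have hint : IsIntegral ℚ_[p] x := Algebra.IsIntegral.isIntegral x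
  rw [spectralNorm, spectralValue_le_one_iff (minpoly.monic hint)]
  constructor
  · intro h k
    rw [minpoly.isIntegrallyClosed_eq_field_fractions' ℚ_[p] h, coeff_map]
    exact PadicInt.norm_le_one _
  · intro h
    have hl : minpoly ℚ_[p] x ∈ lifts (algebraMap ℤ_[p] ℚ_[p]) := by
      rw [lifts_iff_coeff_lifts]
      intro k
      exact ⟨⟨_, h k⟩, rfl⟩
    obtain ⟨g, hg, -, hm⟩ := lifts_and_natDegree_eq_and_monic hl (minpoly.monic hint)
    refine ⟨g, hm, ?_⟩
    rw [← aeval_def, ← aeval_map_algebraMap ℚ_[p] x g, hg, minpoly.aeval]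

theorem stmt2_core {K : Type*} [Field K] [CharZero K] {Ω : Type*} [NormedField Ω]
    [IsUltrametricDist Ω] [Algebra K Ω] [IsAlgClosed Ω] [Algebra.IsAlgebraic K Ω]
    (hinv : ∀ x y : Ω, IsConjRoot K x y → ‖x‖ = ‖y‖)
    (v : AddValuation K (WithTop ℤ)) (π : K) (hπ : v π = ((1 : ℤ) : WithTop ℤ))
    (hle : ∀ x : K, 0 ≤ v x ↔ ‖algebraMap K Ω x‖ ≤ 1)
    (R : Set K) (hR0 : (0 : K) ∈ R)
    (hRrep : ∀ x : K, 0 ≤ v x → ∃ r, r ∈ R ∧ ((1 : ℤ) : WithTop ℤ) ≤ v (x - r))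
    (n : ℕ) (hn : 0 < n) (a0 : ℤ) (b0 : ℕ)
    (α : Ω)
    (hdeg : (minpoly K α).natDegree = n) (hEis : IsEisenstein v (minpoly K α))
    (hdisc : v (Algebra.discr K
        (fun i : Fin n => (IntermediateField.AdjoinSimple.gen K α) ^ (i : ℕ))) =
      (((n : ℤ) + (a0 * n + b0) - 1 : ℤ) : WithTop ℤ)) :
    ∃ β : Ω, K⟮β⟯ = K⟮α⟯ ∧
      (minpoly K β).natDegree = n ∧ IsEisenstein v (minpoly K β) ∧
      ∃ d : ℕ → ℕ → K, (∀ i j, d i j ∈ R) ∧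
        (∀ i j : ℕ, (1 + 2 * (a0 : ℚ) + 2 * (b0 : ℚ) / (n : ℚ)) < (j : ℚ) → d i j = 0) ∧
        ∃ N : ℕ, ∀ i < n, (minpoly K β).coeff i = ∑ j ∈ Finset.range N, d i j * π ^ j := by
  obtain ⟨hmon, hge, hzero⟩ := hEis
  rw [hdeg] at hge
  obtain ⟨hq0, hq1⟩ := norm_pi_lt v π hπ hle
  obtain ⟨hN, hD⟩ := discr_norm hinv α n hdeg
  rw [norm_eq_of_val v π hπ hle hzero, zpow_one] at hN
  rw [norm_eq_of_val v π hπ hle hdisc] at hD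
  have ht0 : 0 < ‖α‖ := by
    rcases (norm_nonneg α).eq_or_lt with h | h
    · rw [← h, zero_pow hn.ne'] at hN
      linarith
    · exact h
  have ht1 : ‖α‖ < 1 := by
    by_contra h
    push Not at h
    have := one_le_pow₀ h (n := n)
    linarith
  generalize hJ : a0 * n + b0 = J at hD
  have hder : ‖aeval α (minpoly K α).derivative‖ = ‖α‖ ^ ((n : ℤ) + J - 1) := by
    refine (pow_left_inj₀ (norm_nonneg _) (zpow_pos ht0 _).le hn.ne').1 ?_
    rw [← hD, hN, ← zpow_natCast, ← zpow_natCast, ← zpow_mul, ← zpow_mul, mul_comm]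
  have hJ0 : 0 ≤ J := by
    have h1 := (core_bound hinv α).1
    rw [hder, hdeg, ← zpow_natCast, zpow_le_zpow_iff_right_of_lt_one₀ ht0 ht1] at h1
    omega
  lift J to ℕ using hJ0
  have hder' : ‖aeval α (minpoly K α).derivative‖ = ‖α‖ ^ (n + J - 1) := by
    rw [hder, ← zpow_natCast]
    congr 1
    omega
  have hnQ : (0 : ℚ) < n := by exact_mod_cast hn
  set s : ℚ := 1 + 2 * (a0 : ℚ) + 2 * (b0 : ℚ) / (n : ℚ) with hs
  have hsn : s * n = n + 2 * J := by
    have : ((J : ℤ) : ℚ) = a0 * n + b0 := by rw [← hJ]; push_cast; ring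
    rw [Int.cast_natCast] at this
    rw [this, hs]
    field_simp
    ring
  have hs1 : 1 ≤ s := by
    refine le_of_mul_le_mul_right ?_ hnQ
    rw [hsn]
    have : (0 : ℚ) ≤ J := by positivity
    linarith
  obtain ⟨c, hc⟩ : ∃ c : ℕ, c = ⌊s⌋₊ + 1 := ⟨_, rfl⟩
  have hsc : s < c := by rw [hc]; push_cast; exact Nat.lt_floor_add_one s
  have hcj : ∀ j : ℕ, s < j → c ≤ j := by
    intro j hj
    have := (Nat.floor_lt (by linarith : (0 : ℚ) ≤ s)).2 hj
    omega
  have hc2 : 2 ≤ c := by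
    have : 1 ≤ ⌊s⌋₊ := Nat.le_floor (by simpa using hs1)
    omega
  have hnc : n + 2 * J + 1 ≤ n * c := by
    have h1 : s * n < c * n := mul_lt_mul_of_pos_right hsc hnQ
    rw [hsn] at h1
    have h2 : n + 2 * J < c * n := by exact_mod_cast h1
    linarith [mul_comm n c]
  have hdig : ∀ i, ∃ d : ℕ → K, (∀ j, d j ∈ R) ∧ (∀ j, c ≤ j → d j = 0) ∧
      (i < n → ((c : ℤ) : WithTop ℤ) ≤
        v ((minpoly K α).coeff i - ∑ j ∈ Finset.range c, d j * π ^ j)) := by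
    intro i
    by_cases hi : i < n
    · obtain ⟨d, h1, h2, h3⟩ := exists_digits v π hπ R hR0 hRrep ((minpoly K α).coeff i)
        (le_trans (by norm_cast) (hge i hi)) c
      exact ⟨d, h1, h2, fun _ => h3⟩
    · exact ⟨fun _ => 0, fun _ => hR0, fun _ _ => rfl, fun h => absurd h hi⟩
  choose d hdR hd0 hdv using hdig
  set e : ℕ → K := fun i => (minpoly K α).coeff i - ∑ j ∈ Finset.range c, d i j * π ^ j with he
  set E : K[X] := ∑ i ∈ Finset.range n, C (e i) * X ^ i with hE
  have hEc : ∀ i, E.coeff i = if i < n then e i else 0 := by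
    intro i
    simp [hE, coeff_X_pow]
  have hEdeg : E.degree < (minpoly K α).degree := by
    rw [degree_eq_natDegree hmon.ne_zero, hdeg, degree_lt_iff_coeff_zero]
    intro m hm
    rw [hEc, if_neg (by omega)]
  have hψm : (minpoly K α - E).Monic := hmon.sub_of_left hEdeg
  have hψn : (minpoly K α - E).natDegree = n := by
    rw [← hdeg]
    exact natDegree_eq_of_degree_eq (degree_sub_eq_left_of_degree_lt hEdeg)
  obtain ⟨β, hβ, hβψ⟩ := core hinv α ht0 ht1 n J hn hdeg hder' (minpoly K α - E) hψm hψn (by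
    intro i
    rw [sub_sub_cancel_left, coeff_neg, map_neg, norm_neg, hEc]
    split_ifs with hi
    · refine (norm_le_of_val v π hπ hle (hdv i hi)).trans ?_
      rw [zpow_natCast, hN, ← pow_mul]
      exact pow_le_pow_of_le_one ht0.le ht1.le hnc
    · simp only [map_zero, norm_zero]
      positivity)
  have hEv : ∀ i < n, ((2 : ℤ) : WithTop ℤ) ≤ v (E.coeff i) := by
    intro i hi
    rw [hEc, if_pos hi]
    refine le_trans ?_ (hdv i hi)
    exact_mod_cast hc2
  refine ⟨β, hβ, by rw [hβψ, hψn], ?_, d, hdR, fun i j hj => hd0 i j (hcj j hj), c, ?_⟩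
  · rw [hβψ]
    refine ⟨hψm, ?_, ?_⟩
    · intro i hi
      rw [hψn] at hi
      rw [coeff_sub]
      exact AddValuation.map_le_sub v (hge i hi) (le_trans (by norm_cast) (hEv i hi))
    · rw [coeff_sub, sub_eq_add_neg, AddValuation.map_add_eq_of_lt_left, hzero]
      rw [AddValuation.map_neg, hzero]
      exact lt_of_lt_of_le (by norm_cast) (hEv 0 hn)
  · intro i hi
    rw [hβψ, coeff_sub, hEc, if_pos hi, he]
    ring

end RamificationStmt2


open RamificationStmt2 in
/-- **Krasner's bound.** Every totally ramified extension `L/K` of degree `n` with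
discriminant `(π)^(n+J₀−1)`, `J₀ = a₀n+b₀`, `0 ≤ b₀ < n` (given by a generator `α` whose minimal
polynomial is Eisenstein of degree `n` and whose power basis has discriminant of valuation
`n+J₀−1`), can be generated by an Eisenstein polynomial `φ` (the minimal polynomial of some `β`
with `K(β) = K(α)`) all of whose `π`-adic coefficient digits `φ_{i,j}` (taken in a fixed set `R`
of representatives of the residue class field containing `0`) vanish for
`j > 1 + 2a₀ + 2b₀/n`. -/
theorem stmt2 {p : ℕ} [Fact p.Prime] {K : Type*} [Field K]
    [Algebra ℚ_[p] K] [FiniteDimensional ℚ_[p] K]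
    [Algebra ℤ_[p] K] [IsScalarTower ℤ_[p] ℚ_[p] K]
    (v : AddValuation K (WithTop ℤ)) (π : K) (hπ : v π = ((1 : ℤ) : WithTop ℤ))
    (hv : ∀ x : K, 0 ≤ v x ↔ IsIntegral ℤ_[p] x)
    (R : Set K) (hR0 : (0 : K) ∈ R)
    (hRrep : ∀ x : K, 0 ≤ v x → ∃! r, r ∈ R ∧ ((1 : ℤ) : WithTop ℤ) ≤ v (x - r))
    (n : ℕ) (hn : 0 < n) (a0 : ℤ) (b0 : ℕ) (hb0 : b0 < n)
    (α : AlgebraicClosure K)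
    (hdeg : (minpoly K α).natDegree = n) (hEis : IsEisenstein v (minpoly K α))
    (hdisc : v (Algebra.discr K
        (fun i : Fin n => (IntermediateField.AdjoinSimple.gen K α) ^ (i : ℕ))) =
      (((n : ℤ) + (a0 * n + b0) - 1 : ℤ) : WithTop ℤ)) :
    ∃ β : AlgebraicClosure K, K⟮β⟯ = K⟮α⟯ ∧
      (minpoly K β).natDegree = n ∧ IsEisenstein v (minpoly K β) ∧
      ∃ d : ℕ → ℕ → K, (∀ i j, d i j ∈ R) ∧
        (∀ i j : ℕ, (1 + 2 * (a0 : ℚ) + 2 * (b0 : ℚ) / (n : ℚ)) < (j : ℚ) → d i j = 0) ∧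
        ∃ N : ℕ, ∀ i < n, (minpoly K β).coeff i = ∑ j ∈ Finset.range N, d i j * π ^ j := by
  have hch : CharZero K := charZero_of_injective_algebraMap (algebraMap ℚ_[p] K).injective
  have halg : Algebra.IsAlgebraic ℚ_[p] (AlgebraicClosure K) :=
    Algebra.IsAlgebraic.trans ℚ_[p] K (AlgebraicClosure K)
  let inst : NormedField (AlgebraicClosure K) :=
    spectralNorm.normedField ℚ_[p] (AlgebraicClosure K)
  have hnorm : ∀ x : AlgebraicClosure K, ‖x‖ = spectralNorm ℚ_[p] (AlgebraicClosure K) x :=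
    fun _ => rfl
  have hu : IsUltrametricDist (AlgebraicClosure K) :=
    IsUltrametricDist.isUltrametricDist_of_isNonarchimedean_norm
      (isNonarchimedean_spectralNorm (K := ℚ_[p]) (L := AlgebraicClosure K))
  refine stmt2_core (Ω := AlgebraicClosure K) ?_ v π hπ ?_ R hR0
    (fun x hx => (hRrep x hx).exists) n hn a0 b0 α hdeg hEis hdisc
  · intro x y hxy
    obtain ⟨σ, hσ⟩ := isConjRoot_iff_exists_algEquiv.mp hxy
    rw [hnorm, hnorm, ← hσ]
    exact (spectralNorm_eq_of_equiv (σ.restrictScalars ℚ_[p]) y).symm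
  · intro x
    rw [hv, isIntegral_iff_spectralNorm, hnorm, ← spectralNorm.eq_of_tower]
end

section
/- Let φ ∈ O_K[x] be Eisenstein of degree n and let P_0 : 𝕂 → 𝕂 be the n-th power map a ↦ a^n. Then: (a) for δ̄ ∈ 𝕂^×, there exists an Eisenstein ψ ∈ O_K[x] with residue(ψ_{0,1}) = δ̄·residue(φ_{0,1}) and K[x]/(ψ) ≅ K[x]/(φ) if and only if δ̄ lies in the image of P_0; (b) if n = p^r for some r ≥ 1, then P_0 is surjective, and hence there exists an Eisenstein ψ with residue(ψ_{0,1}) = 1 such that K[x]/(ψ) ≅ K[x]/(φ). -/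
open Polynomial

namespace RamificationStmt17

variable {K : Type*} [Field K]

def IsEisenstein (v : AddValuation K (WithTop ℤ)) (φ : Polynomial K) : Prop :=
  φ.Monic ∧ (∀ i < φ.natDegree, ((1 : ℤ) : WithTop ℤ) ≤ v (φ.coeff i)) ∧
    v (φ.coeff 0) = ((1 : ℤ) : WithTop ℤ)

/-- The valuation ring `O_K = {x | v(x) ≥ 0}`. -/
def vintegers (v : AddValuation K (WithTop ℤ)) : Subring K where
  carrier := {x | 0 ≤ v x}
  zero_mem' := by simp [AddValuation.map_zero]
  one_mem' := by simp [AddValuation.map_one]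
  add_mem' := by
    intro a b ha hb
    exact le_trans (le_min ha hb) (v.map_add a b)
  neg_mem' := by
    intro a ha
    simpa [AddValuation.map_neg] using ha
  mul_mem' := by
    intro a b ha hb
    simp only [Set.mem_setOf_eq] at *
    rw [v.map_mul]
    exact add_nonneg ha hb

open scoped Classical in
/-- Reduction modulo the maximal ideal, extended by `0` outside the valuation ring. -/
noncomputable def vred {𝕜 : Type*} [Field 𝕜] (v : AddValuation K (WithTop ℤ))
    (res : vintegers v →+* 𝕜) (x : K) : 𝕜 :=
  if h : x ∈ vintegers v then res ⟨x, h⟩ else 0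

theorem eis_decomp {A : Type*} [CommRing A] [IsDomain A] (ϖ : A) (hϖ : ϖ ≠ 0) (φ : A[X]) (n : ℕ)
    (hn : 0 < n) (hm : φ.Monic) (hd : φ.natDegree = n) (hc : ∀ i < n, ϖ ∣ φ.coeff i)
    (a : A) (h0 : φ.coeff 0 = ϖ * a) : ∃ h : A[X], φ = X ^ n + C ϖ * (C a + X * h) := by
  have h1 : C ϖ ∣ φ - X ^ n := by
    rw [C_dvd_iff_dvd_coeff]
    intro i
    rw [coeff_sub, coeff_X_pow]
    rcases lt_trichotomy i n with h | h | h
    · rw [if_neg h.ne, sub_zero]; exact hc i h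
    · subst h
      rw [if_pos rfl, ← hd, hm.coeff_natDegree]; simp
    · rw [if_neg h.ne', coeff_eq_zero_of_natDegree_lt (by omega)]; simp
  obtain ⟨q, hq⟩ := h1
  refine ⟨q.divX, ?_⟩
  have h2 : q.coeff 0 = a := by
    have := congrArg (fun f => f.coeff 0) hq
    simp only [coeff_sub, coeff_X_pow, coeff_C_mul, if_neg hn.ne, sub_zero, h0] at this
    exact (mul_left_cancel₀ hϖ this).symm
  rw [← h2, add_comm (C _), mul_comm X, divX_mul_X_add, ← hq]; ring

theorem eis_core {A K L 𝕜 : Type*} [CommRing A] [IsDomain A] [IsIntegrallyClosed A] [Field K] [Field 𝕜]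
    [Algebra A K] [IsFractionRing A K] [Field L] [Algebra K L] [Algebra A L] [IsScalarTower A K L]
    (ϖ : A) (hϖ : Prime ϖ) (hpow : ∀ x : A, x ≠ 0 → ∃ k : ℕ, x ∣ ϖ ^ k)
    (res : A →+* 𝕜) (hker : ∀ x, res x = 0 ↔ ϖ ∣ x) (n : ℕ) (hn : 0 < n)
    (B : PowerBasis K L) (a b : A) (ha : IsUnit a) (h g : A[X])
    (hφm : (X ^ n + C ϖ * (C a + X * h)).Monic)
    (hφ : minpoly A B.gen = X ^ n + C ϖ * (C a + X * h))
    (hei : (minpoly A B.gen).IsEisensteinAt (Submodule.span A {ϖ}))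
    (β : L) (hψm : (X ^ n + C ϖ * (C b + X * g)).Monic)
    (hβ : aeval β (X ^ n + C ϖ * (C b + X * g)) = 0) : ∃ c : 𝕜, c ^ n * res a = res b := by
  have hα : IsIntegral A B.gen := by
    by_contra hc
    rw [← hφ, minpoly.eq_zero hc] at hφm
    exact hφm.ne_zero rfl
  have hβi : IsIntegral A β := ⟨_, hψm, by rwa [← aeval_def]⟩
  have : Module.IsTorsionFree A L := .trans_faithfulSMul A K L
  have hinj : Function.Injective (algebraMap A L) := FaithfulSMul.algebraMap_injective A L
  -- β in adjoin
  have hβS : β ∈ Algebra.adjoin A {B.gen} := by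
    obtain ⟨q, hq⟩ := B.exists_eq_aeval' β
    obtain ⟨d, hdm, hd⟩ := IsLocalization.integerNormalization_spec (nonZeroDivisors A) q
    obtain ⟨k, e, hk⟩ := hpow d (nonZeroDivisors.ne_zero hdm)
    refine mem_adjoin_of_smul_prime_pow_smul_of_minpoly_isEisensteinAt (n := k) hϖ hα hβi ?_ hei
    rw [hk, mul_comm, mul_smul]
    refine Subalgebra.smul_mem _ ?_ _
    have : d • β = aeval B.gen (IsLocalization.integerNormalization (nonZeroDivisors A) q) := by
      rw [← aeval_map_algebraMap K, hd, hq, ← IsScalarTower.algebraMap_smul K d q, map_smul,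
        IsScalarTower.algebraMap_smul]
    rw [this]
    exact aeval_mem_adjoin_singleton A B.gen
  let S := Algebra.adjoin A {B.gen}
  let α' : S := ⟨B.gen, Algebra.self_mem_adjoin_singleton A B.gen⟩
  let β' : S := ⟨β, hβS⟩
  have hresϖ : res ϖ = 0 := (hker _).2 dvd_rfl
  have hev : eval₂ res 0 (minpoly A B.gen) = 0 := by
    rw [hφ]; simp [hresϖ, hn.ne']
  let ρ : S →+* 𝕜 := (AdjoinRoot.lift res 0 hev).comp (minpoly.equivAdjoin hα).symm.toRingEquiv.toRingHom
  have hρα : ρ α' = 0 := by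
    have : (minpoly.equivAdjoin hα).symm α' = AdjoinRoot.root _ := by
      rw [AlgEquiv.symm_apply_eq]
      apply Subtype.ext
      simp [α']
    change AdjoinRoot.lift res 0 hev ((minpoly.equivAdjoin hα).symm α') = 0
    rw [this, AdjoinRoot.lift_root]
  have hρA (x : A) : ρ (algebraMap A S x) = res x := by
    change AdjoinRoot.lift res 0 hev ((minpoly.equivAdjoin hα).symm (algebraMap A S x)) = _
    rw [AlgEquiv.commutes, AdjoinRoot.algebraMap_eq, AdjoinRoot.lift_of]
  have hSα : aeval α' (X ^ n + C ϖ * (C a + X * h)) = 0 := by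
    apply Subtype.ext
    have := minpoly.aeval A B.gen
    rw [hφ] at this
    simpa [α'] using this
  have hSβ : aeval β' (X ^ n + C ϖ * (C b + X * g)) = 0 := by
    apply Subtype.ext
    simpa [β'] using hβ
  simp only [map_add, map_mul, map_pow, aeval_X, aeval_C] at hSα hSβ
  obtain ⟨a', ha'⟩ := ha.exists_left_inv
  have hϖS : (algebraMap A S ϖ) ≠ 0 := by
    intro h0
    have h2 : algebraMap A L ϖ = 0 := congrArg Subtype.val h0
    rw [map_eq_zero_iff _ hinj] at h2
    exact hϖ.ne_zero h2
  have hϖdvd : α' ∣ algebraMap A S ϖ := by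
    obtain ⟨m, rfl⟩ := Nat.exists_eq_succ_of_ne_zero hn.ne'
    have h1 : algebraMap A S a' * algebraMap A S a = 1 := by rw [← map_mul, ha', map_one]
    refine ⟨-(algebraMap A S a') * (α' ^ m + algebraMap A S ϖ * aeval α' h), ?_⟩
    rw [pow_succ] at hSα
    linear_combination (-algebraMap A S ϖ) * h1 + (algebraMap A S a') * hSα
  have hdvd : ∀ s : S, ρ s = 0 → α' ∣ s := by
    intro s hs
    obtain ⟨q, hq⟩ : ∃ q : A[X], aeval α' q = s := by
      have : (s : L) ∈ Algebra.adjoin A {B.gen} := s.2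
      rw [Algebra.adjoin_singleton_eq_range_aeval] at this
      obtain ⟨q, hq⟩ := this
      refine ⟨q, Subtype.ext ?_⟩
      rw [← hq]
      simpa [α'] using (aeval_algHom_apply S.val α' q).symm
    rw [← q.divX_mul_X_add] at hq
    simp only [map_add, map_mul, aeval_X, aeval_C] at hq
    rw [← hq, map_add, map_mul, hρα, hρA, mul_zero, zero_add, hker] at hs
    rw [← hq]
    exact dvd_add (dvd_mul_left _ _) (hϖdvd.trans (map_dvd _ hs))
  have hρβ : ρ β' = 0 := by
    have := congrArg ρ hSβ
    simp only [map_add, map_mul, map_pow, hρA, hresϖ, map_zero, zero_mul, add_zero] at this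
    exact pow_eq_zero_iff hn.ne' |>.1 this
  obtain ⟨ε, hε⟩ := hdvd _ hρβ
  have key : ε ^ n * (algebraMap A S a + α' * aeval α' h) = algebraMap A S b + β' * aeval β' g := by
    apply mul_left_cancel₀ hϖS
    have : β' ^ n = α' ^ n * ε ^ n := by rw [hε, mul_pow]
    linear_combination ε ^ n * hSα - hSβ + this
  refine ⟨ρ ε, ?_⟩
  have := congrArg ρ key
  simpa only [map_add, map_mul, map_pow, hρA, hρα, hρβ, zero_mul, add_zero] using this

theorem v_ne_zero_int (v : AddValuation K (WithTop ℤ)) {x : K} (hx : x ≠ 0) :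
    ∃ k : ℤ, v x = (k : WithTop ℤ) := by
  have : v x ≠ ⊤ := fun h => hx ((AddValuation.top_iff v).1 h)
  obtain ⟨k, hk⟩ := WithTop.ne_top_iff_exists.1 this
  exact ⟨k, hk.symm⟩

theorem v_inv_int (v : AddValuation K (WithTop ℤ)) {x : K} {k : ℤ} (hx : v x = (k : WithTop ℤ)) :
    v x⁻¹ = ((-k : ℤ) : WithTop ℤ) := by
  have hx0 : x ≠ 0 := by
    rintro rfl
    rw [AddValuation.map_zero] at hx
    exact WithTop.top_ne_coe hx
  obtain ⟨l, hl⟩ := v_ne_zero_int v (inv_ne_zero hx0)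
  have := v.map_mul x x⁻¹
  rw [mul_inv_cancel₀ hx0, v.map_one, hx, hl] at this
  rw [hl]
  norm_cast at this ⊢
  omega

theorem v_pow_int (v : AddValuation K (WithTop ℤ)) {x : K} {k : ℤ} (hx : v x = (k : WithTop ℤ))
    (m : ℕ) : v (x ^ m) = ((m * k : ℤ) : WithTop ℤ) := by
  rw [AddValuation.map_pow, hx, ← WithTop.coe_nsmul]; simp

theorem vint_dvd (v : AddValuation K (WithTop ℤ)) (x y : vintegers v)
    (h : v (x : K) ≤ v (y : K)) : x ∣ y := by
  by_cases hy : (y : K) = 0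
  · rw [show y = 0 from Subtype.ext hy]; exact dvd_zero _
  obtain ⟨l, hl⟩ := v_ne_zero_int v hy
  have hx : (x : K) ≠ 0 := by
    intro h0
    rw [h0, AddValuation.map_zero, hl] at h
    exact WithTop.coe_ne_top (top_le_iff.1 h)
  obtain ⟨k, hk⟩ := v_ne_zero_int v hx
  refine ⟨⟨(y : K) * (x : K)⁻¹, ?_⟩, Subtype.ext ?_⟩
  · change 0 ≤ v _
    rw [v.map_mul, hl, v_inv_int v hk]
    rw [hk, hl] at h
    norm_cast at h ⊢
    omega
  · push_cast; field_simp

theorem vint_dvd_iff (v : AddValuation K (WithTop ℤ)) (x y : vintegers v) :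
    x ∣ y ↔ v (x : K) ≤ v (y : K) := by
  refine ⟨?_, vint_dvd v x y⟩
  rintro ⟨z, rfl⟩
  push_cast
  rw [v.map_mul]
  exact le_add_of_nonneg_right z.2

theorem vint_isUnit (v : AddValuation K (WithTop ℤ)) (x : vintegers v) (h : v (x : K) = 0) :
    IsUnit x := by
  rw [isUnit_iff_dvd_one]
  apply vint_dvd
  rw [h]; simp [v.map_one]

theorem vint_isFractionRing (v : AddValuation K (WithTop ℤ)) : IsFractionRing (vintegers v) K := by
  apply IsFractionRing.of_field
  intro z
  by_cases hz : 0 ≤ v z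
  · exact ⟨⟨z, hz⟩, 1, by simp; rfl⟩
  · have hz0 : z ≠ 0 := by rintro rfl; simp at hz
    obtain ⟨k, hk⟩ := v_ne_zero_int v hz0
    refine ⟨1, ⟨z⁻¹, ?_⟩, ?_⟩
    · change 0 ≤ v _
      rw [v_inv_int v hk]
      rw [hk] at hz
      norm_cast at hz ⊢
      omega
    · rw [map_one]; change z = 1 / z⁻¹; simp

theorem pos_iff_one_le (x : WithTop ℤ) : 0 < x ↔ ((1 : ℤ) : WithTop ℤ) ≤ x := by
  induction x using WithTop.recTopCoe with
  | top => simp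
  | coe a => norm_cast

theorem vint_prime {𝕜 : Type*} [Field 𝕜] (v : AddValuation K (WithTop ℤ)) (π : vintegers v)
    (hπ : v (π : K) = ((1 : ℤ) : WithTop ℤ)) (res : vintegers v →+* 𝕜)
    (hker : ∀ x, res x = 0 ↔ π ∣ x) : Prime π := by
  refine ⟨?_, ?_, ?_⟩
  · rintro h
    rw [h] at hπ
    simp at hπ
  · intro h
    have := (hker 1).2 h.dvd
    simp at this
  · intro a b
    rw [← hker, ← hker, ← hker, map_mul]
    exact mul_eq_zero.1

theorem vint_pow (v : AddValuation K (WithTop ℤ)) (π : vintegers v)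
    (hπ : v (π : K) = ((1 : ℤ) : WithTop ℤ)) (x : vintegers v) (hx : x ≠ 0) :
    ∃ k : ℕ, Associated (π ^ k) x := by
  have hx0 : (x : K) ≠ 0 := fun h => hx (Subtype.ext h)
  obtain ⟨k, hk⟩ := v_ne_zero_int v hx0
  have hk0 : 0 ≤ k := by
    have := x.2
    change 0 ≤ v _ at this
    rw [hk] at this
    exact_mod_cast this
  have h1 : v ((π ^ k.toNat : vintegers v) : K) = v (x : K) := by
    push_cast
    rw [v_pow_int v hπ, hk, Int.toNat_of_nonneg hk0, mul_one]
  exact ⟨k.toNat, associated_of_dvd_dvd (vint_dvd _ _ _ h1.le) (vint_dvd _ _ _ h1.ge)⟩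

theorem vint_lift (v : AddValuation K (WithTop ℤ)) (π : vintegers v)
    (hπ : v (π : K) = ((1 : ℤ) : WithTop ℤ)) (φ : K[X]) (n : ℕ) (hn : 0 < n)
    (hd : φ.natDegree = n) (hE : IsEisenstein v φ) (a : vintegers v)
    (ha : φ.coeff 0 / π = a) :
    ∃ f h : (vintegers v)[X], f.map (algebraMap (vintegers v) K) = φ ∧ f.Monic ∧
      f.natDegree = n ∧ IsUnit a ∧ (∀ i < n, π ∣ f.coeff i) ∧
      f.coeff 0 = π * a ∧ f = X ^ n + C π * (C a + X * h) := by
  obtain ⟨hm, hc, h0⟩ := hE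
  have hπ0 : (π : K) ≠ 0 := by
    intro h
    rw [h] at hπ; simp at hπ
  have hl : φ ∈ lifts (algebraMap (vintegers v) K) := by
    rw [lifts_iff_coeff_lifts]
    intro i
    have : 0 ≤ v (φ.coeff i) := by
      rcases lt_trichotomy i φ.natDegree with h | h | h
      · exact ((pos_iff_one_le _).2 (hc i h)).le
      · rw [h, hm.coeff_natDegree, v.map_one]
      · rw [coeff_eq_zero_of_natDegree_lt h, v.map_zero]; exact le_top
    exact ⟨⟨_, this⟩, rfl⟩
  obtain ⟨f, hf, hfd, hfm⟩ := lifts_and_natDegree_eq_and_monic hl hm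
  have hco (i : ℕ) : ((f.coeff i : vintegers v) : K) = φ.coeff i := by
    rw [← hf, coeff_map]; rfl
  have hdvd : ∀ i < n, π ∣ f.coeff i := by
    intro i hi
    apply vint_dvd
    rw [hπ, hco]
    exact hc i (by omega)
  have hf0 : f.coeff 0 = π * a := by
    apply Subtype.ext
    push_cast
    rw [hco, ← ha]; field_simp
  have hau : IsUnit a := by
    apply vint_isUnit
    rw [← ha, div_eq_mul_inv, v.map_mul, h0, v_inv_int v hπ]
    norm_cast
  obtain ⟨h, hh⟩ := eis_decomp π (fun h => hπ0 (congrArg Subtype.val h)) f n hn hfm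
    (hfd.trans hd) hdvd a hf0
  exact ⟨f, h, hf, hfm, hfd.trans hd, hau, hdvd, hf0, hh⟩

theorem forward {𝕜 : Type*} [Field 𝕜] (v : AddValuation K (WithTop ℤ)) (π : vintegers v)
    (hπ : v (π : K) = ((1 : ℤ) : WithTop ℤ))
    (res : vintegers v →+* 𝕜) (hker : ∀ x, res x = 0 ↔ π ∣ x)
    (φ ψ : K[X]) (n : ℕ) (hn : 0 < n)
    (hd : φ.natDegree = n) (hE : IsEisenstein v φ) (hd' : ψ.natDegree = n) (hE' : IsEisenstein v ψ)
    (a b : vintegers v) (ha : φ.coeff 0 / π = a) (hb : ψ.coeff 0 / π = b)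
    (e : AdjoinRoot ψ →ₐ[K] AdjoinRoot φ) : ∃ c : 𝕜, c ^ n * res a = res b := by
  obtain ⟨f, h, rfl, hfm, hfd, hau, hfc, hf0, hf⟩ := vint_lift v π hπ φ n hn hd hE a ha
  obtain ⟨f', h', rfl, hfm', hfd', hau', hfc', hf0', hf'⟩ := vint_lift v π hπ ψ n hn hd' hE' b hb
  have := vint_isFractionRing v
  have hp := vint_prime v π hπ res hker
  have : UniqueFactorizationMonoid (vintegers v) :=
    IsDiscreteValuationRing.HasUnitMulPowIrreducibleFactorization.toUniqueFactorizationMonoid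
      ⟨π, hp.irreducible, fun {x} hx => vint_pow v π hπ x hx⟩
  have hei : f.IsEisensteinAt (Submodule.span (vintegers v) {π}) := by
    refine ⟨?_, ?_, ?_⟩
    · rw [hfm.leadingCoeff]
      intro h1
      exact hp.not_dvd_one (Ideal.mem_span_singleton.1 h1)
    · intro i hi
      exact Ideal.mem_span_singleton.2 (hfc i (hfd ▸ hi))
    · intro h1
      rw [← Ideal.span, Ideal.span_singleton_pow, Ideal.mem_span_singleton, hf0, sq] at h1
      exact hp.not_unit (isUnit_of_dvd_unit ((mul_dvd_mul_iff_left hp.ne_zero).1 h1) hau)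
  have hirr : Irreducible f := hei.irreducible
    ((Ideal.span_singleton_prime hp.ne_zero).2 hp) hfm.isPrimitive (hfd ▸ hn)
  have hirrK : Irreducible (f.map (algebraMap (vintegers v) K)) :=
    (hfm.irreducible_iff_irreducible_map_fraction_map).1 hirr
  have : Fact (Irreducible (f.map (algebraMap (vintegers v) K))) := ⟨hirrK⟩
  let B := AdjoinRoot.powerBasis hirrK.ne_zero
  have hBg : B.gen = AdjoinRoot.root _ := AdjoinRoot.powerBasis_gen _
  have hB0 : aeval B.gen f = 0 := by
    rw [← aeval_map_algebraMap K, hBg, AdjoinRoot.aeval_eq, AdjoinRoot.mk_self]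
  have hBi : IsIntegral (vintegers v) B.gen := ⟨f, hfm, hB0⟩
  have hmin : minpoly (vintegers v) B.gen = f := by
    apply map_injective (algebraMap (vintegers v) K) (IsFractionRing.injective _ _)
    rw [← minpoly.isIntegrallyClosed_eq_field_fractions' K hBi]
    symm
    apply minpoly.eq_of_irreducible_of_monic hirrK _ (hfm.map _)
    rw [aeval_map_algebraMap, hB0]
  have hβ : aeval (e (AdjoinRoot.root _)) f' = 0 := by
    rw [← aeval_map_algebraMap K, aeval_algHom_apply, AdjoinRoot.aeval_eq, AdjoinRoot.mk_self,
      map_zero]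
  obtain ⟨β, hβ⟩ : ∃ β : AdjoinRoot (f.map (algebraMap (vintegers v) K)), aeval β f' = 0 := ⟨_, hβ⟩
  rw [hf'] at hβ
  refine eis_core (K := K) π hp ?_ res hker n hn B a b hau h h' (by rw [← hf]; exact hfm) (hmin.trans hf)
    (by rw [hmin]; exact hei) β (by rw [← hf']; exact hfm') hβ
  intro x hx
  obtain ⟨k, hk⟩ := vint_pow v π hπ x hx
  exact ⟨k, hk.symm.dvd⟩

theorem scale_equiv (φ : K[X]) (u : K) (hu : u ≠ 0) :
    Nonempty (AdjoinRoot (φ.scaleRoots u) ≃ₐ[K] AdjoinRoot φ) := by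
  have key : ∀ (f : K[X]) (w : K), aeval (algebraMap K (AdjoinRoot f) w * AdjoinRoot.root f)
      (f.scaleRoots w) = 0 := fun f w => scaleRoots_aeval_eq_zero (by
        rw [AdjoinRoot.aeval_eq, AdjoinRoot.mk_self])
  have hback : (φ.scaleRoots u).scaleRoots u⁻¹ = φ := by
    rw [← scaleRoots_mul, mul_inv_cancel₀ hu, scaleRoots_one]
  have key2 := key (φ.scaleRoots u) u⁻¹
  rw [hback] at key2
  refine ⟨AlgEquiv.ofAlgHom (AdjoinRoot.liftAlgHom _ (Algebra.ofId _ _) _ (by rw [Algebra.toRingHom_ofId]; exact key φ u))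
    (AdjoinRoot.liftAlgHom _ (Algebra.ofId _ _) _ (by rw [Algebra.toRingHom_ofId]; exact key2)) ?_ ?_⟩
  · apply AdjoinRoot.algHom_ext
    simp only [AlgHom.comp_apply, AdjoinRoot.liftAlgHom_root, map_mul, AlgHom.commutes, AlgHom.id_apply]
    rw [← mul_assoc, ← map_mul, inv_mul_cancel₀ hu, map_one, one_mul]
  · apply AdjoinRoot.algHom_ext
    simp only [AlgHom.comp_apply, AdjoinRoot.liftAlgHom_root, map_mul, AlgHom.commutes, AlgHom.id_apply]
    rw [← mul_assoc, ← map_mul, mul_inv_cancel₀ hu, map_one, one_mul]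

theorem eis_div_mem (v : AddValuation K (WithTop ℤ)) (π : K) (hπ : v π = ((1 : ℤ) : WithTop ℤ))
    (φ : K[X]) (hE : IsEisenstein v φ) : v (φ.coeff 0 / π) = 0 := by
  rw [div_eq_mul_inv, v.map_mul, hE.2.2, v_inv_int v hπ]
  norm_cast

theorem vred_eq {𝕜 : Type*} [Field 𝕜] (v : AddValuation K (WithTop ℤ))
    (res : vintegers v →+* 𝕜) (x : vintegers v) : vred v res (x : K) = res x := by
  unfold vred
  rw [dif_pos x.2]

theorem backward {𝕜 : Type*} [Field 𝕜] (v : AddValuation K (WithTop ℤ)) (π : K)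
    (hπ : v π = ((1 : ℤ) : WithTop ℤ))
    (res : vintegers v →+* 𝕜) (hres_surj : Function.Surjective res)
    (hres_ker : ∀ x : vintegers v, res x = 0 ↔ 0 < v (x : K))
    (φ : K[X]) (n : ℕ) (hn : 0 < n) (hd : φ.natDegree = n) (hE : IsEisenstein v φ)
    (a : 𝕜) (ha : a ≠ 0) : ∃ ψ : Polynomial K, IsEisenstein v ψ ∧ ψ.natDegree = n ∧
          vred v res (ψ.coeff 0 / π) = a ^ n * vred v res (φ.coeff 0 / π) ∧
          Nonempty (AdjoinRoot ψ ≃ₐ[K] AdjoinRoot φ) := by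
  obtain ⟨u, rfl⟩ := hres_surj a
  have hvu : v (u : K) = 0 := by
    have h1 : ¬ 0 < v (u : K) := fun h => ha ((hres_ker u).2 h)
    exact le_antisymm (not_lt.1 h1) u.2
  have hvp (m : ℕ) : v ((u : K) ^ m) = 0 := by
    rw [AddValuation.map_pow, hvu, nsmul_zero]
  have hu0 : (u : K) ≠ 0 := by
    intro h
    rw [h] at hvu; simp at hvu
  refine ⟨φ.scaleRoots u, ⟨(monic_scaleRoots_iff _).2 hE.1, ?_, ?_⟩,
    (natDegree_scaleRoots _ _).trans hd, ?_, scale_equiv φ u hu0⟩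
  · intro i hi
    rw [natDegree_scaleRoots] at hi
    rw [coeff_scaleRoots, v.map_mul, hvp, add_zero]
    exact hE.2.1 i hi
  · rw [coeff_scaleRoots, v.map_mul, hvp, add_zero]
    exact hE.2.2
  · have h1 := eis_div_mem v π hπ φ hE
    let x : vintegers v := ⟨φ.coeff 0 / π, h1.ge⟩
    have e1 : φ.coeff 0 / π = (x : K) := rfl
    have e2 : (φ.scaleRoots (u : K)).coeff 0 / π = ((u ^ n * x : vintegers v) : K) := by
      push_cast
      rw [coeff_scaleRoots, ← e1, hd, Nat.sub_zero]; ring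
    rw [e2, e1, vred_eq, vred_eq, map_mul, map_pow]

end RamificationStmt17
open RamificationStmt17 in
/-- Let `φ ∈ O_K[x]` be Eisenstein of degree `n` and `P₀ : 𝕜 → 𝕜`, `a ↦ aⁿ`,
the `n`-th power map on the residue field.  Note that for Eisenstein `ψ`, the first `π`-adic
digit `ψ_{0,1}` of the constant coefficient has residue `residue(ψ₀/π)`.  Then:
(a) for `δ̄ ∈ 𝕜ˣ` there is an Eisenstein `ψ ∈ O_K[x]` (of degree `n`) with
`residue(ψ_{0,1}) = δ̄·residue(φ_{0,1})` and `K[x]/(ψ) ≅ K[x]/(φ)` iff `δ̄` lies in the image of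
`P₀`;
(b) if `n = p^r`, `r ≥ 1`, then `P₀` is surjective and there is an Eisenstein `ψ` with
`residue(ψ_{0,1}) = 1` and `K[x]/(ψ) ≅ K[x]/(φ)`. -/
theorem stmt17 {p : ℕ} [Fact p.Prime] {K 𝕜 : Type*} [Field K] [Field 𝕜] [Finite 𝕜]
    [Algebra ℚ_[p] K] [FiniteDimensional ℚ_[p] K]
    [Algebra ℤ_[p] K] [IsScalarTower ℤ_[p] ℚ_[p] K]
    (v : AddValuation K (WithTop ℤ)) (π : K) (hπ : v π = ((1 : ℤ) : WithTop ℤ))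
    (hv : ∀ x : K, 0 ≤ v x ↔ IsIntegral ℤ_[p] x)
    (res : vintegers v →+* 𝕜) (hres_surj : Function.Surjective res)
    (hres_ker : ∀ x : vintegers v, res x = 0 ↔ 0 < v (x : K))
    (hchar𝕜 : (p : 𝕜) = 0)
    (φ : Polynomial K) (n : ℕ) (hn : 0 < n) (hdeg : φ.natDegree = n)
    (hEis : IsEisenstein v φ) :
    -- (a)
    (∀ δ : 𝕜, δ ≠ 0 →
      ((∃ ψ : Polynomial K, IsEisenstein v ψ ∧ ψ.natDegree = n ∧
          vred v res (ψ.coeff 0 / π) = δ * vred v res (φ.coeff 0 / π) ∧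
          Nonempty (AdjoinRoot ψ ≃ₐ[K] AdjoinRoot φ)) ↔
        (∃ a : 𝕜, a ^ n = δ))) ∧
    -- (b)
    ((∃ r : ℕ, 1 ≤ r ∧ n = p ^ r) →
      Function.Surjective (fun a : 𝕜 => a ^ n) ∧
      ∃ ψ : Polynomial K, IsEisenstein v ψ ∧ ψ.natDegree = n ∧
        vred v res (ψ.coeff 0 / π) = 1 ∧
        Nonempty (AdjoinRoot ψ ≃ₐ[K] AdjoinRoot φ)) := by
  have hvφ := eis_div_mem v π hπ φ hEis
  let xφ : vintegers v := ⟨φ.coeff 0 / π, hvφ.ge⟩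
  have exφ : φ.coeff 0 / π = (xφ : K) := rfl
  have hxφ : res xφ ≠ 0 := by
    intro h
    have := (hres_ker _).1 h
    change 0 < v (φ.coeff 0 / π) at this
    rw [hvφ] at this
    exact lt_irrefl _ this
  have hπ0 : 0 ≤ v π := by rw [hπ]; norm_cast
  let π' : vintegers v := ⟨π, hπ0⟩
  have hker : ∀ x, res x = 0 ↔ π' ∣ x := by
    intro x
    rw [hres_ker, vint_dvd_iff, pos_iff_one_le]
    change _ ↔ v π ≤ _
    rw [hπ]
  refine ⟨fun δ hδ => ⟨?_, ?_⟩, ?_⟩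
  · rintro ⟨ψ, hψE, hψd, hψ, ⟨e⟩⟩
    let xψ : vintegers v := ⟨ψ.coeff 0 / π, (eis_div_mem v π hπ ψ hψE).ge⟩
    have exψ : ψ.coeff 0 / π = (xψ : K) := rfl
    obtain ⟨c, hc⟩ := forward v π' hπ res hker φ ψ n hn hdeg hEis hψd hψE xφ xψ rfl rfl
      e.toAlgHom
    refine ⟨c, ?_⟩
    rw [exφ, exψ, vred_eq, vred_eq, ← hc] at hψ
    exact mul_right_cancel₀ hxφ hψ
  · rintro ⟨a, rfl⟩
    have ha : a ≠ 0 := by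
      rintro rfl
      exact hδ (zero_pow hn.ne')
    exact backward v π hπ res hres_surj hres_ker φ n hn hdeg hEis a ha
  · rintro ⟨r, hr, rfl⟩
    have hcp : CharP 𝕜 p := by
      have h1 : ringChar 𝕜 ∣ p := (ringChar.spec 𝕜 p).1 hchar𝕜
      have h2 : ringChar 𝕜 = p := ((Nat.dvd_prime Fact.out).1 h1).resolve_left (CharP.ringChar_ne_one)
      exact ringChar.of_eq h2
    have hsurj : Function.Surjective (fun a : 𝕜 => a ^ p ^ r) := by
      have hinj : Function.Injective (iterateFrobenius 𝕜 p r) := RingHom.injective _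
      exact Finite.surjective_of_injective hinj
    refine ⟨hsurj, ?_⟩
    obtain ⟨a, ha⟩ := hsurj (res xφ)⁻¹
    have ha' : a ^ p ^ r = (res xφ)⁻¹ := ha
    have ha0 : a ≠ 0 := by
      rintro rfl
      rw [zero_pow hn.ne'] at ha'
      exact inv_ne_zero hxφ ha'.symm
    obtain ⟨ψ, h1, h2, h3, h4⟩ := backward v π hπ res hres_surj hres_ker φ _ hn hdeg hEis a ha0
    refine ⟨ψ, h1, h2, ?_, h4⟩
    rw [h3, ha', exφ, vred_eq, inv_mul_cancel₀ hxφ]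
end
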